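/- arXiv:math/0611654 — 3 statements merged into one kernel-verified Lean document; each statement's English description precedes it below -/
import Mathlib

section
/- Let Ω ⊆ ℝ² be open, u : Ω → ℝ a minimal graph, and R = [a₁,b₁] × [a₂,b₂] a closed rectangle contained in Ω. Then the circulation of the conjugate vector field F_u = (−∂₂u/W_u, ∂₁u/W_u) around the positively oriented boundary of R vanishes: ∫_{a₁}^{b₁} (F_u)₁(x, a₂) dx + ∫_{a₂}^{b₂} (F_u)₂(b₁, y) dy − ∫_{a₁}^{b₁} (F_u)₁(x, b₂) dx − ∫_{a₂}^{b₂} (F_u)₂(a₁, y) dy = 0. (This is the statement ∫_{∂D} dψ_u = 0 for D ⊆ Ω.) -/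
open Set Filter Topology Metric
open scoped RealInnerProductSpace

noncomputable section

/-- The plane `ℝ²` with the Euclidean metric. -/
abbrev Pt : Type := EuclideanSpace ℝ (Fin 2)

/-- The point of `ℝ²` with coordinates `(a, b)`. -/
def vec2 (a b : ℝ) : Pt := (WithLp.equiv 2 (Fin 2 → ℝ)).symm ![a, b]

/-- `W_u = √(1 + ‖∇u‖²)`. -/
def Wu (u : Pt → ℝ) (p : Pt) : ℝ := Real.sqrt (1 + ‖gradient u p‖ ^ 2)

/-- The conjugate vector field `F_u = (−∂₂u/W_u, ∂₁u/W_u)` of a minimal graph `u`. -/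
def conjField (u : Pt → ℝ) (p : Pt) : Pt :=
  (Wu u p)⁻¹ • vec2 (-(gradient u p 1)) (gradient u p 0)

/-- `u` is a minimal graph on the open set `Ω`: it is `C²` on `Ω` and satisfies the minimal
surface equation `div (∇u / √(1 + ‖∇u‖²)) = 0` there, the divergence being the sum of the
partial derivatives of the components of the normalized gradient field. -/
def MinimalGraph (Ω : Set Pt) (u : Pt → ℝ) : Prop :=
  IsOpen Ω ∧ ContDiffOn ℝ 2 u Ω ∧
    ∀ p ∈ Ω, (∑ i : Fin 2,
      fderiv ℝ (fun q => (Wu u q)⁻¹ • gradient u q) p (EuclideanSpace.single i 1) i) = 0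

/-- `ψ` is a conjugate function of `u` on `Ω`: it is differentiable with `∇ψ = F_u` on `Ω`. -/
def IsConjugate (Ω : Set Pt) (u ψ : Pt → ℝ) : Prop :=
  ∀ p ∈ Ω, DifferentiableAt ℝ ψ p ∧ gradient ψ p = conjField u p

/-- The normalized gradient field. -/
def nGrad (u : Pt → ℝ) (q : Pt) : Pt := (Wu u q)⁻¹ • gradient u q

theorem nGrad_differentiableAt {Ω : Set Pt} {u : Pt → ℝ} (hΩ : IsOpen Ω)
    (hu : ContDiffOn ℝ 2 u Ω) {p : Pt} (hp : p ∈ Ω) : DifferentiableAt ℝ (nGrad u) p := by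
  have h1 : ContDiffAt ℝ 2 u p := hu.contDiffAt (hΩ.mem_nhds hp)
  have h2 : ContDiffAt ℝ 1 (fderiv ℝ u) p := h1.fderiv_right (by norm_num)
  have h3 : DifferentiableAt ℝ (fderiv ℝ u) p := h2.differentiableAt (by norm_num)
  have h4 : DifferentiableAt ℝ (gradient u) p :=
    ((InnerProductSpace.toDual ℝ Pt).symm.toContinuousLinearEquiv.differentiableAt).comp p h3
  have h5 : DifferentiableAt ℝ (Wu u) p := by
    unfold Wu
    refine DifferentiableAt.sqrt ((differentiableAt_const _).add (h4.norm_sq ℝ)) ?_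
    positivity
  refine (h5.inv ?_).smul h4
  unfold Wu
  positivity

/-- The linear map `(x, y) ↦ vec2 x y`. -/
def vecL : ℝ × ℝ →L[ℝ] Pt :=
  ((PiLp.continuousLinearEquiv 2 ℝ (fun _ : Fin 2 => ℝ)).symm : (Fin 2 → ℝ) →L[ℝ] Pt).comp
    ((ContinuousLinearEquiv.finTwoArrow ℝ ℝ).symm : ℝ × ℝ →L[ℝ] (Fin 2 → ℝ))

theorem vecL_apply (x : ℝ × ℝ) : vecL x = vec2 x.1 x.2 := by
  ext i
  fin_cases i <;> simp [vecL, vec2]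

/-- The circulation of the conjugate vector field `F_u` of a minimal graph around the
positively oriented boundary of any closed rectangle contained in `Ω` vanishes:
`∫_{∂D} dψ_u = 0`. -/
theorem circulation_vanishes
    (Ω : Set Pt) (u : Pt → ℝ) (hu : MinimalGraph Ω u)
    (a₁ b₁ a₂ b₂ : ℝ) (h₁ : a₁ ≤ b₁) (h₂ : a₂ ≤ b₂)
    (hR : {p : Pt | p 0 ∈ Icc a₁ b₁ ∧ p 1 ∈ Icc a₂ b₂} ⊆ Ω) :
    (∫ x in a₁..b₁, conjField u (vec2 x a₂) 0) +
    (∫ y in a₂..b₂, conjField u (vec2 b₁ y) 1) -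
    (∫ x in a₁..b₁, conjField u (vec2 x b₂) 0) -
    (∫ y in a₂..b₂, conjField u (vec2 a₁ y) 1) = 0 := by
  obtain ⟨hΩ, hC, hdiv⟩ := hu
  have hmem : ∀ x : ℝ × ℝ, x ∈ uIcc a₁ b₁ ×ˢ uIcc a₂ b₂ → vecL x ∈ Ω := by
    intro x hx
    rw [uIcc_of_le h₁, uIcc_of_le h₂] at hx
    apply hR
    rw [vecL_apply]
    exact ⟨by simpa [vec2] using hx.1, by simpa [vec2] using hx.2⟩
  have hd : ∀ i : Fin 2, ∀ x : ℝ × ℝ, x ∈ uIcc a₁ b₁ ×ˢ uIcc a₂ b₂ →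
      HasFDerivAt (fun x => nGrad u (vecL x) i)
        ((EuclideanSpace.proj i : Pt →L[ℝ] ℝ).comp ((fderiv ℝ (nGrad u) (vecL x)).comp vecL)) x := by
    intro i x hx
    exact (EuclideanSpace.proj i : Pt →L[ℝ] ℝ).hasFDerivAt.comp x
      ((nGrad_differentiableAt hΩ hC (hmem x hx)).hasFDerivAt.comp x vecL.hasFDerivAt)
  have hz : ∀ x : ℝ × ℝ, x ∈ uIcc a₁ b₁ ×ˢ uIcc a₂ b₂ →
      ((EuclideanSpace.proj 0 : Pt →L[ℝ] ℝ).comp ((fderiv ℝ (nGrad u) (vecL x)).comp vecL)) (1, 0)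
      + ((EuclideanSpace.proj 1 : Pt →L[ℝ] ℝ).comp
        ((fderiv ℝ (nGrad u) (vecL x)).comp vecL)) (0, 1) = 0 := by
    intro x hx
    have h := hdiv _ (hmem x hx)
    have e0 : vecL (1, 0) = EuclideanSpace.single 0 1 := by
      rw [vecL_apply]; ext i; fin_cases i <;> simp [vec2]
    have e1 : vecL (0, 1) = EuclideanSpace.single 1 1 := by
      rw [vecL_apply]; ext i; fin_cases i <;> simp [vec2]
    rw [Fin.sum_univ_two] at h
    simp only [ContinuousLinearMap.comp_apply, e0, e1]
    exact h
  have hsub : Ioo (min a₁ b₁) (max a₁ b₁) ×ˢ Ioo (min a₂ b₂) (max a₂ b₂) ⊆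
      uIcc a₁ b₁ ×ˢ uIcc a₂ b₂ := prod_mono Ioo_subset_Icc_self Ioo_subset_Icc_self
  have key := MeasureTheory.integral2_divergence_prod_of_hasFDerivAt
    (fun x => nGrad u (vecL x) 0) (fun x => nGrad u (vecL x) 1) _ _ a₁ a₂ b₁ b₂
    (fun x hx => (hd 0 x hx).continuousAt.continuousWithinAt)
    (fun x hx => (hd 1 x hx).continuousAt.continuousWithinAt)
    (fun x hx => hd 0 x (hsub hx)) (fun x hx => hd 1 x (hsub hx))
    ((MeasureTheory.integrableOn_zero).congr_fun (fun x hx => (hz x hx).symm)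
      (measurableSet_uIcc.prod measurableSet_uIcc))
  have hI : (∫ x in a₁..b₁, ∫ y in a₂..b₂,
      (((EuclideanSpace.proj 0 : Pt →L[ℝ] ℝ).comp
        ((fderiv ℝ (nGrad u) (vecL (x, y))).comp vecL)) (1, 0)
      + ((EuclideanSpace.proj 1 : Pt →L[ℝ] ℝ).comp
        ((fderiv ℝ (nGrad u) (vecL (x, y))).comp vecL)) (0, 1))) = ∫ x in a₁..b₁, (0 : ℝ) := by
    refine intervalIntegral.integral_congr fun x hx => ?_
    refine (intervalIntegral.integral_congr (g := fun _ => (0 : ℝ)) fun y hy => ?_).trans (by simp)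
    exact hz (x, y) ⟨hx, hy⟩
  rw [hI] at key
  have c0 : ∀ x y, conjField u (vec2 x y) 0 = -(nGrad u (vecL (x, y)) 1) := by
    intro x y
    rw [vecL_apply]
    simp [conjField, nGrad, vec2]
  have c1 : ∀ x y, conjField u (vec2 x y) 1 = nGrad u (vecL (x, y)) 0 := by
    intro x y
    rw [vecL_apply]
    simp [conjField, nGrad, vec2]
  simp only [c0, c1, intervalIntegral.integral_neg]
  simp only [intervalIntegral.integral_zero] at key
  linarith
end
end

section
/- Let Ω ⊆ ℝ² be an open convex set, u : Ω → ℝ a minimal graph, ψ a conjugate function of u, and ψ̄ its continuous extension to the closure of Ω. Let a ≠ b be points of the frontier of Ω such that the open segment T = (a,b) is contained in the frontier of Ω, oriented so that Ω lies on the left of the direction b − a. Then ψ̄(b) − ψ̄(a) = ‖b − a‖ if and only if u(x) → +∞ as x → t within Ω for every t ∈ T, and ψ̄(b) − ψ̄(a) = −‖b − a‖ if and only if u(x) → −∞ as x → t within Ω for every t ∈ T. In all cases |ψ̄(b) − ψ̄(a)| ≤ ‖b − a‖. -/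
open Set Filter Topology Metric
open scoped RealInnerProductSpace

noncomputable section

/-! ### Smooth truncation -/

lemma hasDerivAt_max_sq (s : ℝ) : HasDerivAt (fun s : ℝ => (max s 0) ^ 2) (2 * max s 0) s := by
  rcases lt_trichotomy s 0 with h | h | h
  · rw [max_eq_right h.le]
    have : (fun s : ℝ => (max s 0) ^ 2) =ᶠ[𝓝 s] fun _ => 0 := by
      filter_upwards [Iio_mem_nhds h] with x hx
      rw [max_eq_right (le_of_lt hx)]; norm_num
    simpa using (hasDerivAt_const s (0:ℝ)).congr_of_eventuallyEq this
  · subst h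
    have : HasDerivAt (fun s : ℝ => (max s 0) ^ 2) 0 0 := by
      rw [hasDerivAt_iff_isLittleO_nhds_zero]
      have h1 : (fun h : ℝ => h ^ 2) =o[𝓝 0] fun h : ℝ => h := by
        simpa using (Asymptotics.isLittleO_pow_id (𝕜 := ℝ) (n := 2) (by norm_num))
      refine Asymptotics.IsBigO.trans_isLittleO (Asymptotics.isBigO_of_le _ fun x => ?_) h1
      simp only [zero_add, max_self, smul_zero, sub_zero, Real.norm_eq_abs, abs_pow]
      norm_num
      rcases le_total x 0 with h | h
      · rw [max_eq_right h]; nlinarith [sq_nonneg x]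
      · rw [max_eq_left h]
    simpa using this
  · rw [max_eq_left h.le]
    have : (fun s : ℝ => (max s 0) ^ 2) =ᶠ[𝓝 s] fun s => s ^ 2 := by
      filter_upwards [Ioi_mem_nhds h] with x hx
      rw [max_eq_left (le_of_lt hx)]
    simpa using (hasDerivAt_pow 2 s).congr_of_eventuallyEq this

/-- A bounded `C¹` truncation function vanishing on the negative axis. -/
def th (s : ℝ) : ℝ := (max s 0) ^ 2 / (1 + (max s 0) ^ 2)

/-- Its derivative. -/
def thd (s : ℝ) : ℝ := 2 * max s 0 / (1 + (max s 0) ^ 2) ^ 2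

lemma hasDerivAt_th (s : ℝ) : HasDerivAt th (thd s) s := by
  have h := hasDerivAt_max_sq s
  have h2 : HasDerivAt (fun s : ℝ => 1 + (max s 0) ^ 2) (2 * max s 0) s := h.const_add 1
  have h3 := h.div h2 (by positivity)
  refine HasDerivAt.congr_deriv (f := th) h3 ?_
  unfold thd
  ring

lemma contDiff_th : ContDiff ℝ 1 th := by
  rw [contDiff_one_iff_deriv]
  refine ⟨fun s => (hasDerivAt_th s).differentiableAt, ?_⟩
  have : deriv th = thd := funext fun s => (hasDerivAt_th s).deriv
  rw [this]
  unfold thd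
  refine Continuous.div (by fun_prop) (by fun_prop) fun s => by positivity

lemma th_nonneg (s : ℝ) : 0 ≤ th s := by unfold th; positivity
lemma th_le_one (s : ℝ) : th s ≤ 1 := by
  unfold th; rw [div_le_one (by positivity)]; linarith
lemma th_zero {s : ℝ} (h : s ≤ 0) : th s = 0 := by unfold th; rw [max_eq_right h]; simp
lemma th_half {s : ℝ} (h : 1 ≤ s) : 1 / 2 ≤ th s := by
  unfold th; rw [max_eq_left (by linarith), le_div_iff₀ (by positivity)]; nlinarith
lemma thd_nonneg (s : ℝ) : 0 ≤ thd s := by unfold thd; positivity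
lemma thd_pos {s : ℝ} (h : 0 < s) : 0 < thd s := by
  unfold thd; rw [max_eq_left h.le]; positivity
lemma thd_le (s : ℝ) : thd s ≤ 1 := by
  unfold thd
  rw [div_le_one (by positivity)]
  nlinarith [sq_nonneg (max s 0 - 1), sq_nonneg ((max s 0)^2), sq_nonneg (max s 0)]

/-! ### Partial derivatives in the plane `ℝ × ℝ` -/

/-- first partial -/
def dX (f : ℝ × ℝ → ℝ) (p : ℝ × ℝ) : ℝ := fderiv ℝ f p (1, 0)
/-- second partial -/
def dY (f : ℝ × ℝ → ℝ) (p : ℝ × ℝ) : ℝ := fderiv ℝ f p (0, 1)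
/-- area element -/
def WW (f : ℝ × ℝ → ℝ) (p : ℝ × ℝ) : ℝ := Real.sqrt (1 + dX f p ^ 2 + dY f p ^ 2)

lemma fderiv_contDiffOn {O : Set (ℝ × ℝ)} (hO : IsOpen O) {f : ℝ × ℝ → ℝ}
    (hf : ContDiffOn ℝ 2 f O) : ContDiffOn ℝ 1 (fderiv ℝ f) O :=
  hf.fderiv_of_isOpen hO (by norm_num)

lemma dX_contDiffOn {O : Set (ℝ × ℝ)} (hO : IsOpen O) {f : ℝ × ℝ → ℝ}
    (hf : ContDiffOn ℝ 2 f O) : ContDiffOn ℝ 1 (dX f) O :=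
  (fderiv_contDiffOn hO hf).clm_apply contDiffOn_const

lemma dY_contDiffOn {O : Set (ℝ × ℝ)} (hO : IsOpen O) {f : ℝ × ℝ → ℝ}
    (hf : ContDiffOn ℝ 2 f O) : ContDiffOn ℝ 1 (dY f) O :=
  (fderiv_contDiffOn hO hf).clm_apply contDiffOn_const

lemma dX_continuousOn {O : Set (ℝ × ℝ)} (hO : IsOpen O) {f : ℝ × ℝ → ℝ}
    (hf : ContDiffOn ℝ 1 f O) : ContinuousOn (dX f) O :=
  (hf.continuousOn_fderiv_of_isOpen hO (by norm_num)).clm_apply continuousOn_const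

lemma dY_continuousOn {O : Set (ℝ × ℝ)} (hO : IsOpen O) {f : ℝ × ℝ → ℝ}
    (hf : ContDiffOn ℝ 1 f O) : ContinuousOn (dY f) O :=
  (hf.continuousOn_fderiv_of_isOpen hO (by norm_num)).clm_apply continuousOn_const

lemma diffAt_of {O : Set (ℝ × ℝ)} (hO : IsOpen O) {f : ℝ × ℝ → ℝ}
    (hf : ContDiffOn ℝ 1 f O) {p : ℝ × ℝ} (hp : p ∈ O) : DifferentiableAt ℝ f p :=
  ((hf p hp).contDiffAt (hO.mem_nhds hp)).differentiableAt (by norm_num)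

lemma mixed_symm {O : Set (ℝ × ℝ)} (hO : IsOpen O) {Q : ℝ × ℝ → ℝ}
    (hQ : ContDiffOn ℝ 2 Q O) {p : ℝ × ℝ} (hp : p ∈ O) :
    dX (dY Q) p = dY (dX Q) p := by
  have hs : IsSymmSndFDerivAt ℝ Q p :=
    ((hQ p hp).contDiffAt (hO.mem_nhds hp)).isSymmSndFDerivAt (by simp)
  have hd : DifferentiableAt ℝ (fderiv ℝ Q) p :=
    ((fderiv_contDiffOn hO hQ p hp).contDiffAt (hO.mem_nhds hp)).differentiableAt (by norm_num)
  have e1 : ∀ v w : ℝ × ℝ, fderiv ℝ (fun q => fderiv ℝ Q q v) p w = fderiv ℝ (fderiv ℝ Q) p w v := by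
    intro v w
    rw [fderiv_clm_apply hd (differentiableAt_const v)]
    simp
  have := hs (1, 0) (0, 1)
  unfold dX dY
  rw [e1, e1, this]

/-- Green's formula for `φ dQ`. -/
lemma green {O : Set (ℝ × ℝ)} (hO : IsOpen O) {φ Q : ℝ × ℝ → ℝ}
    (hφ : ContDiffOn ℝ 1 φ O) (hQ : ContDiffOn ℝ 2 Q O) {a1 a2 b1 b2 : ℝ}
    (h1 : a1 ≤ b1) (h2 : a2 ≤ b2) (hsub : Icc (a1, a2) (b1, b2) ⊆ O) :
    (∫ p in Icc (a1, a2) (b1, b2), (dX φ p * dY Q p - dY φ p * dX Q p)) =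
      (-(∫ x in a1..b1, φ (x, b2) * dX Q (x, b2)) + ∫ x in a1..b1, φ (x, a2) * dX Q (x, a2)) +
      (∫ y in a2..b2, φ (b1, y) * dY Q (b1, y)) - ∫ y in a2..b2, φ (a1, y) * dY Q (a1, y) := by
  have hf : ContDiffOn ℝ 1 (fun p => φ p * dY Q p) O := hφ.mul (dY_contDiffOn hO hQ)
  have hg : ContDiffOn ℝ 1 (fun p => -(φ p * dX Q p)) O := (hφ.mul (dX_contDiffOn hO hQ)).neg
  have hin : Ioo a1 b1 ×ˢ Ioo a2 b2 ⊆ O := by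
    rintro ⟨x, y⟩ ⟨hx, hy⟩
    exact hsub ⟨⟨hx.1.le, hy.1.le⟩, ⟨hx.2.le, hy.2.le⟩⟩
  have key := MeasureTheory.integral_divergence_prod_Icc_of_hasFDerivAt_off_countable_of_le
    (fun p => φ p * dY Q p) (fun p => -(φ p * dX Q p))
    (fderiv ℝ (fun p => φ p * dY Q p)) (fderiv ℝ (fun p => -(φ p * dX Q p)))
    (a1, a2) (b1, b2) ⟨h1, h2⟩ ∅ countable_empty
    (hf.continuousOn.mono hsub) (hg.continuousOn.mono hsub)
    (fun p hp => (diffAt_of hO hf (hin hp.1)).hasFDerivAt)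
    (fun p hp => (diffAt_of hO hg (hin hp.1)).hasFDerivAt)
    (((dX_continuousOn hO hf).add (dY_continuousOn hO hg)).mono hsub |>.integrableOn_compact
      isCompact_Icc)
  have hcongr : (∫ p in Icc (a1, a2) (b1, b2), (dX φ p * dY Q p - dY φ p * dX Q p)) =
      ∫ p in Icc (a1, a2) (b1, b2), fderiv ℝ (fun p => φ p * dY Q p) p (1, 0) +
        fderiv ℝ (fun p => -(φ p * dX Q p)) p (0, 1) := by
    refine MeasureTheory.setIntegral_congr_fun measurableSet_Icc fun p hp => ?_
    have hpO := hsub hp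
    have dφ := diffAt_of hO hφ hpO
    have d1 := diffAt_of hO (dX_contDiffOn hO hQ) hpO
    have d2 := diffAt_of hO (dY_contDiffOn hO hQ) hpO
    have e1 : fderiv ℝ (fun p => φ p * dY Q p) p (1, 0) = φ p * dX (dY Q) p + dY Q p * dX φ p := by
      rw [fderiv_fun_mul dφ d2]; simp [dX]
    have e2 : fderiv ℝ (fun p => -(φ p * dX Q p)) p (0, 1) =
        -(φ p * dY (dX Q) p + dX Q p * dY φ p) := by
      rw [fderiv_fun_neg, fderiv_fun_mul dφ d1]; simp [dY]
    beta_reduce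
    rw [e1, e2, mixed_symm hO hQ hpO]
    ring
  rw [hcongr, key]
  simp only [intervalIntegral.integral_neg]
  ring

/-- A minimal graph together with its conjugate function, in coordinates. -/
structure CPair (O : Set (ℝ × ℝ)) (U P : ℝ × ℝ → ℝ) : Prop where
  op : IsOpen O
  cd : ContDiffOn ℝ 2 U O
  diff : ∀ p ∈ O, DifferentiableAt ℝ P p
  dx : ∀ p ∈ O, dX P p = -(dY U p) / WW U p
  dy : ∀ p ∈ O, dY P p = dX U p / WW U p

lemma WW_pos (f : ℝ × ℝ → ℝ) (p) : 0 < WW f p := by unfold WW; positivity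
lemma WW_sq (f : ℝ × ℝ → ℝ) (p) : WW f p ^ 2 = 1 + dX f p ^ 2 + dY f p ^ 2 := by
  unfold WW; rw [Real.sq_sqrt (by positivity)]

lemma fderiv_eq_dXdY (f : ℝ × ℝ → ℝ) (p : ℝ × ℝ) :
    fderiv ℝ f p = dX f p • ContinuousLinearMap.fst ℝ ℝ ℝ + dY f p • ContinuousLinearMap.snd ℝ ℝ ℝ := by
  ext <;> simp [dX, dY]

lemma CPair.cdP {O U P} (h : CPair O U P) : ContDiffOn ℝ 2 P O := by
  have h1 := dX_contDiffOn h.op h.cd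
  have h2 := dY_contDiffOn h.op h.cd
  have hW : ContDiffOn ℝ 1 (WW U) O := by
    refine ContDiffOn.sqrt ((contDiffOn_const.add (h1.pow 2)).add (h2.pow 2)) fun p _ => ?_
    positivity
  have : ContDiffOn ℝ (1 + 1) P O := by
    rw [contDiffOn_succ_iff_fderiv_of_isOpen h.op]
    refine ⟨fun p hp => (h.diff p hp).differentiableWithinAt, by simp, ?_⟩
    have : ContDiffOn ℝ 1 (fun p => (-(dY U p) / WW U p) • ContinuousLinearMap.fst ℝ ℝ ℝ +
        (dX U p / WW U p) • ContinuousLinearMap.snd ℝ ℝ ℝ) O :=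
      ((h2.neg.div hW fun p _ => (WW_pos U p).ne').smul contDiffOn_const).add
        ((h1.div hW fun p _ => (WW_pos U p).ne').smul contDiffOn_const)
    refine this.congr fun p hp => ?_
    rw [fderiv_eq_dXdY, h.dx p hp, h.dy p hp]
  simpa [one_add_one_eq_two] using this

lemma CPair.abs_dx_le {O U P} (h : CPair O U P) {p} (hp : p ∈ O) : |dX P p| ≤ 1 := by
  rw [h.dx p hp, abs_div, abs_of_pos (WW_pos U p), div_le_one (WW_pos U p), abs_neg]
  refine abs_le_of_sq_le_sq ?_ (WW_pos U p).le
  rw [WW_sq]; nlinarith [sq_nonneg (dX U p)]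

lemma CPair.abs_dy_le {O U P} (h : CPair O U P) {p} (hp : p ∈ O) : |dY P p| ≤ 1 := by
  rw [h.dy p hp, abs_div, abs_of_pos (WW_pos U p), div_le_one (WW_pos U p)]
  refine abs_le_of_sq_le_sq ?_ (WW_pos U p).le
  rw [WW_sq]; nlinarith [sq_nonneg (dY U p)]

lemma hasDerivAt_line {f : ℝ × ℝ → ℝ} {x y : ℝ} (h : DifferentiableAt ℝ f (x, y)) :
    HasDerivAt (fun s => f (s, y)) (dX f (x, y)) x := by
  have h1 : HasDerivAt (fun s : ℝ => (s, y)) ((1 : ℝ), (0 : ℝ)) x :=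
    (hasDerivAt_id x).prodMk (hasDerivAt_const x y)
  exact h.hasFDerivAt.comp_hasDerivAt x h1

lemma hasDerivAt_col {f : ℝ × ℝ → ℝ} {x y : ℝ} (h : DifferentiableAt ℝ f (x, y)) :
    HasDerivAt (fun s => f (x, s)) (dY f (x, y)) y := by
  have h1 : HasDerivAt (fun s : ℝ => (x, s)) ((0 : ℝ), (1 : ℝ)) y :=
    (hasDerivAt_const y x).prodMk (hasDerivAt_id y)
  exact h.hasFDerivAt.comp_hasDerivAt y h1

/-- The defect integral along a horizontal segment. -/
lemma CPair.integral_defect {O U P} (h : CPair O U P) {c d y : ℝ} (hcd : c ≤ d)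
    (hs : ∀ x ∈ Icc c d, (x, y) ∈ O) :
    ∫ x in c..d, (1 - dX P (x, y)) = (d - c) - (P (d, y) - P (c, y)) := by
  have hcont : ContinuousOn (fun x => dX P (x, y)) (uIcc c d) := by
    rw [uIcc_of_le hcd]
    exact (dX_contDiffOn h.op h.cdP).continuousOn.comp (by fun_prop) hs
  have e := intervalIntegral.integral_eq_sub_of_hasDerivAt
    (f := fun x => P (x, y)) (f' := fun x => dX P (x, y)) (a := c) (b := d)
    (fun x hx => hasDerivAt_line (h.diff _ (hs x (by rwa [uIcc_of_le hcd] at hx))))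
    hcont.intervalIntegrable
  rw [intervalIntegral.integral_sub intervalIntegrable_const hcont.intervalIntegrable, e]
  simp

lemma th_comp_contDiffOn {O : Set (ℝ × ℝ)} {g : ℝ × ℝ → ℝ} (hg : ContDiffOn ℝ 1 g O) :
    ContDiffOn ℝ 1 (fun p => th (g p)) O := contDiff_th.comp_contDiffOn hg

lemma th_comp_fderiv {g : ℝ × ℝ → ℝ} {p : ℝ × ℝ} (hg : DifferentiableAt ℝ g p) (v : ℝ × ℝ) :
    fderiv ℝ (fun p => th (g p)) p v = thd (g p) * fderiv ℝ g p v := by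
  have := (hasDerivAt_th (g p)).comp_hasFDerivAt p hg.hasFDerivAt
  have h2 := this.fderiv
  change fderiv ℝ (th ∘ g) p v = _
  rw [h2]; simp

lemma volume_real_box {a1 a2 b1 b2 : ℝ} (h1 : a1 ≤ b1) (h2 : a2 ≤ b2) :
    MeasureTheory.volume.real (Icc (a1, a2) (b1, b2)) = (b1 - a1) * (b2 - a2) := by
  rw [Icc_prod_eq, MeasureTheory.Measure.volume_eq_prod, MeasureTheory.measureReal_prod_prod]
  simp [h1, h2]

/-- pointwise inequality `|∇u|²/W + u_y ≥ -1`. -/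
lemma grad_ineq (a b W : ℝ) (hW : 0 < W) (h : W ^ 2 = 1 + a ^ 2 + b ^ 2) :
    -1 ≤ a * (a / W) - b * (-b / W - 1) := by
  have e : a * (a / W) - b * (-b / W - 1) = W - 1 / W + b := by
    field_simp; nlinarith
  have h1 : 1 ≤ W := by nlinarith [sq_nonneg a, sq_nonneg b]
  have h2 : |b| ≤ W := abs_le_of_sq_le_sq (by nlinarith [sq_nonneg a]) hW.le
  have h3 : 1 / W ≤ 1 := by rw [div_le_one hW]; exact h1
  have := (abs_le.1 h2).1
  rw [e]; linarith

lemma coreB {O U P} (h : CPair O U P) {c d r l : ℝ} (hcd : c < d) (hr : 0 < r)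
    (hsub : ∀ x ∈ Icc c d, ∀ y ∈ Ioc 0 r, (x, y) ∈ O)
    (hlim : ∀ A, ∃ η0 > 0, ∀ y ∈ Ioo 0 η0, ∀ x ∈ Icc c d, A ≤ U (x, y))
    (hl : Tendsto (fun y => P (d, y) - P (c, y)) (𝓝[>] 0) (𝓝 l)) : d - c ≤ l := by
  have key : ∀ k ∈ Ioc 0 r, (d - c) - l ≤ (4 + 2 * (d - c)) * k := by
    intro k hk
    have hcomp : IsCompact ((fun x => (x, k)) '' Icc c d) := isCompact_Icc.image (by fun_prop)
    obtain ⟨A, hA⟩ := (hcomp.image_of_continuousOn (h.cd.continuousOn.mono (by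
      rintro _ ⟨x, hx, rfl⟩; exact hsub x hx k hk))).bddAbove
    have hA' : ∀ x ∈ Icc c d, U (x, k) ≤ A := fun x hx => hA ⟨_, ⟨x, hx, rfl⟩, rfl⟩
    obtain ⟨η0, hη0, hη⟩ := hlim (A + 1)
    have hev : ∀ᶠ y in 𝓝[>] (0:ℝ), (d - c) - (P (d, y) - P (c, y)) ≤ (4 + 2 * (d - c)) * k := by
      have h1 : Ioo 0 (min η0 k) ∈ 𝓝[>] (0:ℝ) := Ioo_mem_nhdsGT (lt_min hη0 hk.1)
      filter_upwards [h1] with η hηm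
      have hη1 : η < η0 := hηm.2.trans_le (min_le_left _ _)
      have hη2 : η < k := hηm.2.trans_le (min_le_right _ _)
      have hbox : Icc (c, η) (d, k) ⊆ O := by
        rintro ⟨x, y⟩ ⟨⟨h1, h2⟩, ⟨h3, h4⟩⟩
        exact hsub x ⟨h1, h3⟩ y ⟨hηm.1.trans_le h2, le_trans h4 hk.2⟩
      have hU1 : ContDiffOn ℝ 1 (fun p => U p - A) O :=
        (h.cd.of_le (by norm_num)).sub contDiffOn_const
      have hφ := th_comp_contDiffOn hU1
      have hQ : ContDiffOn ℝ 2 (fun p : ℝ × ℝ => P p - p.1) O := h.cdP.sub contDiff_fst.contDiffOn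
      have dQx : ∀ p ∈ O, dX (fun p : ℝ × ℝ => P p - p.1) p = dX P p - 1 := by
        intro p hp
        unfold dX
        rw [fderiv_fun_sub (h.diff p hp) differentiableAt_fst, fderiv_fst]; simp
      have dQy : ∀ p ∈ O, dY (fun p : ℝ × ℝ => P p - p.1) p = dY P p := by
        intro p hp
        unfold dY
        rw [fderiv_fun_sub (h.diff p hp) differentiableAt_fst, fderiv_fst]; simp
      have G := green h.op hφ hQ hcd.le hη2.le hbox
      -- lower bound of the left side
      have hcI : ContinuousOn (fun p => dX (fun p => th (U p - A)) p * dY (fun p : ℝ × ℝ => P p - p.1) p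
          - dY (fun p => th (U p - A)) p * dX (fun p : ℝ × ℝ => P p - p.1) p) O :=
        ((dX_continuousOn h.op hφ).mul (dY_contDiffOn h.op hQ).continuousOn).sub
          ((dY_continuousOn h.op hφ).mul (dX_contDiffOn h.op hQ).continuousOn)
      have L : -((d - c) * (k - η)) ≤ ∫ p in Icc (c, η) (d, k),
          (dX (fun p => th (U p - A)) p * dY (fun p : ℝ × ℝ => P p - p.1) p
          - dY (fun p => th (U p - A)) p * dX (fun p : ℝ × ℝ => P p - p.1) p) := by
        have e : -((d - c) * (k - η)) = ∫ p in Icc (c, η) (d, k), (-1 : ℝ) := by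
          rw [MeasureTheory.setIntegral_const, volume_real_box hcd.le hη2.le]; simp
        rw [e]
        refine MeasureTheory.setIntegral_mono_on
          (continuousOn_const.integrableOn_compact isCompact_Icc)
          ((hcI.mono hbox).integrableOn_compact isCompact_Icc) measurableSet_Icc fun p hp => ?_
        have hpO := hbox hp
        have dg := diffAt_of h.op hU1 hpO
        have e1 : dX (fun p => th (U p - A)) p = thd (U p - A) * dX U p := by
          unfold dX; rw [th_comp_fderiv dg, fderiv_sub_const]
        have e2 : dY (fun p => th (U p - A)) p = thd (U p - A) * dY U p := by
          unfold dY; rw [th_comp_fderiv dg, fderiv_sub_const]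
        rw [e1, e2, dQx p hpO, dQy p hpO, h.dx p hpO, h.dy p hpO]
        have := grad_ineq (dX U p) (dY U p) (WW U p) (WW_pos U p) (WW_sq U p)
        have t0 := thd_nonneg (U p - A)
        have t1 := thd_le (U p - A)
        nlinarith
      -- the top
      have T : ∫ x in c..d, th (U (x, k) - A) * dX (fun p : ℝ × ℝ => P p - p.1) (x, k) = 0 := by
        rw [intervalIntegral.integral_congr (g := fun _ => (0:ℝ))]
        · simp
        · intro x hx
          rw [uIcc_of_le hcd.le] at hx
          have := hA' x hx
          simp only []
          rw [th_zero (by linarith), zero_mul]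
      -- the sides
      have S : ∀ x ∈ Icc c d,
          |∫ y in η..k, th (U (x, y) - A) * dY (fun p : ℝ × ℝ => P p - p.1) (x, y)| ≤ k := by
        intro x hx
        have := intervalIntegral.norm_integral_le_of_norm_le_const (a := η) (b := k) (C := 1)
          (f := fun y => th (U (x, y) - A) * dY (fun p : ℝ × ℝ => P p - p.1) (x, y)) (by
            intro y hy
            rw [uIoc_of_le hη2.le] at hy
            have hO := hsub x hx y ⟨hηm.1.trans hy.1, hy.2.trans hk.2⟩
            rw [dQy _ hO, norm_mul, Real.norm_eq_abs, Real.norm_eq_abs, abs_of_nonneg (th_nonneg _)]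
            exact mul_le_one₀ (th_le_one _) (abs_nonneg _) (h.abs_dy_le hO))
        rw [Real.norm_eq_abs, abs_of_pos (sub_pos.2 hη2)] at this
        linarith [hηm.1]
      -- the bottom
      have hbot : ∀ x ∈ Icc c d, (x, η) ∈ O := fun x hx => hsub x hx η ⟨hηm.1, hη2.le.trans hk.2⟩
      have hline : ContinuousOn (fun x : ℝ => (x, η)) (Icc c d) := by fun_prop
      have B : ∫ x in c..d, th (U (x, η) - A) * dX (fun p : ℝ × ℝ => P p - p.1) (x, η) ≤
          -(1 / 2) * ((d - c) - (P (d, η) - P (c, η))) := by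
        rw [← h.integral_defect hcd.le hbot, ← intervalIntegral.integral_const_mul]
        refine intervalIntegral.integral_mono_on hcd.le ?_ ?_ fun x hx => ?_
        · refine ContinuousOn.intervalIntegrable ?_
          rw [uIcc_of_le hcd.le]
          exact (hφ.continuousOn.mul (dX_contDiffOn h.op hQ).continuousOn).comp hline hbot
        · refine ContinuousOn.intervalIntegrable ?_
          rw [uIcc_of_le hcd.le]
          exact continuousOn_const.mul (continuousOn_const.sub
            ((dX_contDiffOn h.op h.cdP).continuousOn.comp hline hbot))
        · have h1 := hη η ⟨hηm.1, hη1⟩ x hx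
          rw [dQx _ (hbot x hx)]
          have h2 := th_half (s := U (x, η) - A) (by linarith)
          have h3 := (abs_le.1 (h.abs_dx_le (hbot x hx))).2
          nlinarith
      have S1 := (abs_le.1 (S c ⟨le_rfl, hcd.le⟩)).1
      have S2 := (abs_le.1 (S d ⟨hcd.le, le_rfl⟩)).2
      rw [T] at G
      have : (d - c) * (k - η) ≤ (d - c) * k :=
        mul_le_mul_of_nonneg_left (by linarith [hηm.1]) (by linarith)
      linarith
    exact le_of_tendsto (tendsto_const_nhds.sub hl) hev
  have hlast : Tendsto (fun k : ℝ => (4 + 2 * (d - c)) * k) (𝓝[>] 0) (𝓝 0) := by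
    have : Continuous fun k : ℝ => (4 + 2 * (d - c)) * k := by fun_prop
    simpa using (this.tendsto 0).mono_left nhdsWithin_le_nhds
  have := ge_of_tendsto hlast (by
    filter_upwards [Ioc_mem_nhdsGT hr] with k hk using key k hk)
  linarith

/-! ### Monotonicity of the mean curvature operator -/

lemma mono_aux (a b a' b' W W' : ℝ) (hW : 0 < W) (hW' : 0 < W')
    (h : W ^ 2 = 1 + a ^ 2 + b ^ 2) (h' : W' ^ 2 = 1 + a' ^ 2 + b' ^ 2) :
    0 ≤ (a - a') * (a / W - a' / W') - (b - b') * (-b / W - -b' / W') ∧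
    ((a - a') * (a / W - a' / W') - (b - b') * (-b / W - -b' / W') ≤ 0 → a = a' ∧ b = b') := by
  have e : (a - a') * (a / W - a' / W') - (b - b') * (-b / W - -b' / W') =
      (W + W') / (W * W') * (W * W' - (1 + a * a' + b * b')) := by
    field_simp
    linear_combination (-W') * h - W * h'
  have lag : (W * W') ^ 2 - (1 + a * a' + b * b') ^ 2 =
      (a - a') ^ 2 + (b - b') ^ 2 + (a * b' - b * a') ^ 2 := by
    rw [mul_pow, h, h']; ring
  have cs : 1 + a * a' + b * b' ≤ W * W' := by
    refine (abs_le_of_sq_le_sq' ?_ (by positivity)).2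
    nlinarith [sq_nonneg (a - a'), sq_nonneg (b - b'), sq_nonneg (a * b' - b * a')]
  have hpos : 0 < (W + W') / (W * W') := by positivity
  rw [e]
  refine ⟨mul_nonneg hpos.le (by linarith), fun hle => ?_⟩
  have hz : W * W' - (1 + a * a' + b * b') ≤ 0 := by
    by_contra hcon
    push Not at hcon
    exact absurd (mul_pos hpos hcon) (not_lt.2 hle)
  have heq : W * W' = 1 + a * a' + b * b' := by linarith
  rw [heq, sub_self] at lag
  constructor
  · nlinarith [sq_nonneg (a - a'), sq_nonneg (b - b'), sq_nonneg (a * b' - b * a')]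
  · nlinarith [sq_nonneg (a - a'), sq_nonneg (b - b'), sq_nonneg (a * b' - b * a')]

/-! ### Scherk's surface -/

/-- Scherk's surface. -/
def skU (k c C : ℝ) (p : ℝ × ℝ) : ℝ :=
  (Real.log (Real.sin (k * (p.1 - c))) - Real.log (Real.sin (k * p.2))) / k - C
/-- Its conjugate function. -/
def skP (k c : ℝ) (p : ℝ × ℝ) : ℝ :=
  -(Real.arcsin (Real.cos (k * (p.1 - c)) * Real.cos (k * p.2))) / k
/-- Its domain. -/
def skO (k c : ℝ) : Set (ℝ × ℝ) :=
  {p | k * (p.1 - c) ∈ Ioo 0 Real.pi ∧ k * p.2 ∈ Ioo 0 Real.pi}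

lemma dXdY_of {f : ℝ × ℝ → ℝ} {p : ℝ × ℝ} {α β : ℝ}
    (h : HasFDerivAt f (α • ContinuousLinearMap.fst ℝ ℝ ℝ + β • ContinuousLinearMap.snd ℝ ℝ ℝ) p) :
    dX f p = α ∧ dY f p = β := by
  unfold dX dY; rw [h.fderiv]; simp

lemma skX (k c : ℝ) (p : ℝ × ℝ) :
    HasFDerivAt (fun p : ℝ × ℝ => k * (p.1 - c)) (k • ContinuousLinearMap.fst ℝ ℝ ℝ) p :=
  ((hasFDerivAt_fst (p := p)).sub_const c).const_mul k

lemma skY (k : ℝ) (p : ℝ × ℝ) :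
    HasFDerivAt (fun p : ℝ × ℝ => k * p.2) (k • ContinuousLinearMap.snd ℝ ℝ ℝ) p :=
  (hasFDerivAt_snd (p := p)).const_mul k

lemma scherk_pair {k : ℝ} (hk : 0 < k) (c C : ℝ) : CPair (skO k c) (skU k c C) (skP k c) := by
  have hop : IsOpen (skO k c) := by
    refine IsOpen.inter ?_ ?_
    · exact isOpen_Ioo.preimage (f := fun p : ℝ × ℝ => k * (p.1 - c)) (by fun_prop)
    · exact isOpen_Ioo.preimage (f := fun p : ℝ × ℝ => k * p.2) (by fun_prop)
  have hs1 : ∀ p ∈ skO k c, 0 < Real.sin (k * (p.1 - c)) := fun p hp =>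
    Real.sin_pos_of_pos_of_lt_pi hp.1.1 hp.1.2
  have hs2 : ∀ p ∈ skO k c, 0 < Real.sin (k * p.2) := fun p hp =>
    Real.sin_pos_of_pos_of_lt_pi hp.2.1 hp.2.2
  have hU : ∀ p ∈ skO k c, dX (skU k c C) p =
      Real.cos (k * (p.1 - c)) / Real.sin (k * (p.1 - c)) ∧
      dY (skU k c C) p = -(Real.cos (k * p.2) / Real.sin (k * p.2)) := by
    intro p hp
    apply dXdY_of
    have h1 := ((skX k c p).sin.log (hs1 p hp).ne')
    have h2 := ((skY k p).sin.log (hs2 p hp).ne')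
    have h3 := ((h1.sub h2).mul_const (k⁻¹)).sub_const C
    refine HasFDerivAt.congr_fderiv (f := skU k c C) h3 ?_
    ext <;> simp <;> field_simp
  have hlt : ∀ p ∈ skO k c, 0 < 1 - (Real.cos (k * (p.1 - c)) * Real.cos (k * p.2)) ^ 2 := by
    intro p hp
    have a1 := hs1 p hp
    have a2 := hs2 p hp
    have b1 := Real.sin_sq_add_cos_sq (k * (p.1 - c))
    have b2 := Real.sin_sq_add_cos_sq (k * p.2)
    have : 0 < Real.sin (k * (p.1 - c)) ^ 2 := by positivity
    nlinarith [sq_nonneg (Real.cos (k * p.2)), sq_nonneg (Real.cos (k * (p.1 - c))), sq_nonneg (Real.sin (k * p.2)),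
      mul_nonneg (sq_nonneg (Real.cos (k * (p.1 - c)))) (sq_nonneg (Real.sin (k * p.2)))]
  have hP : ∀ p ∈ skO k c, HasFDerivAt (skP k c)
      ((Real.cos (k * p.2) * Real.sin (k * (p.1 - c)) /
        Real.sqrt (1 - (Real.cos (k * (p.1 - c)) * Real.cos (k * p.2)) ^ 2)) •
          ContinuousLinearMap.fst ℝ ℝ ℝ +
       (Real.cos (k * (p.1 - c)) * Real.sin (k * p.2) /
        Real.sqrt (1 - (Real.cos (k * (p.1 - c)) * Real.cos (k * p.2)) ^ 2)) •
          ContinuousLinearMap.snd ℝ ℝ ℝ) p := by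
    intro p hp
    have hl := hlt p hp
    have h1 := (skX k c p).cos.mul (skY k p).cos
    have h2 := Real.hasDerivAt_arcsin
      (x := Real.cos (k * (p.1 - c)) * Real.cos (k * p.2))
      (by intro hc; rw [hc] at hl; norm_num at hl) (by intro hc; rw [hc] at hl; norm_num at hl)
    have h3 := (h2.comp_hasFDerivAt p h1).neg.mul_const (k⁻¹)
    refine HasFDerivAt.congr_fderiv (f := skP k c) h3 ?_
    ext <;> simp <;> field_simp
  have hW : ∀ p ∈ skO k c, WW (skU k c C) p =
      Real.sqrt (1 - (Real.cos (k * (p.1 - c)) * Real.cos (k * p.2)) ^ 2) /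
        (Real.sin (k * (p.1 - c)) * Real.sin (k * p.2)) := by
    intro p hp
    have a1 := hs1 p hp
    have a2 := hs2 p hp
    have b1 := Real.sin_sq_add_cos_sq (k * (p.1 - c))
    have b2 := Real.sin_sq_add_cos_sq (k * p.2)
    unfold WW
    rw [(hU p hp).1, (hU p hp).2, Real.sqrt_eq_iff_mul_self_eq (by positivity) (by positivity),
      div_mul_div_comm, Real.mul_self_sqrt (hlt p hp).le]
    generalize Real.sin (k * (p.1 - c)) = s at *
    generalize Real.cos (k * (p.1 - c)) = t at *
    generalize Real.sin (k * p.2) = s' at *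
    generalize Real.cos (k * p.2) = t' at *
    have e1 : t ^ 2 = 1 - s ^ 2 := by linarith
    have e2 : t' ^ 2 = 1 - s' ^ 2 := by linarith
    field_simp
    rw [e1, e2]; ring
  refine ⟨hop, ?_, fun p hp => (hP p hp).differentiableAt, fun p hp => ?_, fun p hp => ?_⟩
  · unfold skU
    refine ContDiffOn.sub (ContDiffOn.div_const (ContDiffOn.sub ?_ ?_) _) contDiffOn_const
    · refine ContDiffOn.log (ContDiff.contDiffOn (by fun_prop)) fun p hp => (hs1 p hp).ne'
    · refine ContDiffOn.log (ContDiff.contDiffOn (by fun_prop)) fun p hp => (hs2 p hp).ne'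
  · have a1 := hs1 p hp
    have a2 := hs2 p hp
    have := Real.sqrt_pos.2 (hlt p hp)
    rw [(dXdY_of (hP p hp)).1, hW p hp, (hU p hp).2]
    field_simp
  · have a1 := hs1 p hp
    have a2 := hs2 p hp
    have := Real.sqrt_pos.2 (hlt p hp)
    rw [(dXdY_of (hP p hp)).2, hW p hp, (hU p hp).1]
    field_simp

/-- Scherk's surface tends to `-∞` at the vertical sides. -/
lemma scherk_sides {k c d h0 : ℝ} (hk : 0 < k) (hd : k * (d - c) = Real.pi)
    (hh : k * h0 = Real.pi / 2) {η : ℝ} (hη : 0 < η) (C B : ℝ) :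
    ∀ᶠ δ in 𝓝[>] (0:ℝ), ∀ y ∈ Icc η h0, skU k c C (c + δ, y) ≤ B ∧ skU k c C (d - δ, y) ≤ B := by
  have h1 : Tendsto (fun δ : ℝ => Real.sin (k * δ)) (𝓝[>] 0) (𝓝[>] 0) := by
    refine tendsto_nhdsWithin_iff.2 ⟨?_, ?_⟩
    · have : Continuous fun δ : ℝ => Real.sin (k * δ) := by fun_prop
      simpa using (this.tendsto 0).mono_left nhdsWithin_le_nhds
    · have : Ioo 0 (Real.pi / k) ∈ 𝓝[>] (0:ℝ) := Ioo_mem_nhdsGT (by positivity)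
      filter_upwards [this] with δ hδ
      refine Real.sin_pos_of_pos_of_lt_pi (mul_pos hk hδ.1) ?_
      have := hδ.2
      rw [lt_div_iff₀ hk] at this
      linarith
  have h2 := Real.tendsto_log_nhdsGT_zero.comp h1
  filter_upwards [h2.eventually_le_atBot (k * (B + C) + Real.log (Real.sin (k * η)))] with δ hδ y hy
  simp only [Function.comp] at hδ
  have hpi := Real.pi_pos
  have hky : k * η ≤ k * y := mul_le_mul_of_nonneg_left hy.1 hk.le
  have hky2 : k * y ≤ k * h0 := mul_le_mul_of_nonneg_left hy.2 hk.le
  have hkη : 0 < k * η := mul_pos hk hη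
  have hlog : Real.log (Real.sin (k * η)) ≤ Real.log (Real.sin (k * y)) := by
    refine Real.log_le_log (Real.sin_pos_of_pos_of_lt_pi hkη (by linarith)) ?_
    exact Real.sin_le_sin_of_le_of_le_pi_div_two (by linarith) (by linarith) hky
  have e1 : k * (c + δ - c) = k * δ := by ring
  have e2 : Real.sin (k * (d - δ - c)) = Real.sin (k * δ) := by
    rw [show k * (d - δ - c) = k * (d - c) - k * δ by ring, hd, Real.sin_pi_sub]
  unfold skU
  simp only [e1, e2, and_self]
  rw [sub_le_iff_le_add, div_le_iff₀ hk]
  linarith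

lemma coreA {O U P} (h : CPair O U P) {k c d h0 : ℝ} (hk : 0 < k) (hd : k * (d - c) = Real.pi)
    (hh : k * h0 = Real.pi / 2)
    (hsub : ∀ x ∈ Icc c d, ∀ y ∈ Ioc 0 h0, (x, y) ∈ O)
    (hl : Tendsto (fun y => P (d, y) - P (c, y)) (𝓝[>] 0) (𝓝 (d - c))) :
    ∃ C, ∀ x ∈ Ioo c d, ∀ y ∈ Ioc 0 h0, skU k c C (x, y) ≤ U (x, y) := by
  have hpi := Real.pi_pos
  have hcd : c < d := by
    have : 0 < d - c := pos_of_mul_pos_right (by rw [hd]; exact hpi) hk.le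
    linarith
  have hh0 : 0 < h0 := pos_of_mul_pos_right (by rw [hh]; positivity) hk.le
  -- the constant
  obtain ⟨C, hC⟩ : ∃ C, ∀ x ∈ Icc c d, -C ≤ U (x, h0) := by
    have hcomp : IsCompact ((fun x => (x, h0)) '' Icc c d) := isCompact_Icc.image (by fun_prop)
    obtain ⟨A, hA⟩ := (hcomp.image_of_continuousOn (h.cd.continuousOn.mono (by
      rintro _ ⟨x, hx, rfl⟩; exact hsub x hx h0 ⟨hh0, le_rfl⟩))).bddBelow
    exact ⟨-A, fun x hx => by rw [neg_neg]; exact hA ⟨_, ⟨x, hx, rfl⟩, rfl⟩⟩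
  refine ⟨C, ?_⟩
  have hV := scherk_pair hk c C
  set V := skU k c C with hVdef
  set R := skP k c with hRdef
  set O' := O ∩ skO k c with hO'
  have opO' : IsOpen O' := h.op.inter hV.op
  have hmemS : ∀ x ∈ Ioo c d, ∀ y ∈ Ioc 0 h0, (x, y) ∈ skO k c := by
    intro x hx y hy
    refine ⟨⟨mul_pos hk (sub_pos.2 hx.1), ?_⟩, ⟨mul_pos hk hy.1, ?_⟩⟩
    · rw [← hd]; exact mul_lt_mul_of_pos_left (by simpa using hx.2) hk
    · have : k * y ≤ k * h0 := mul_le_mul_of_nonneg_left hy.2 hk.le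
      simp only []; linarith
  have hmem : ∀ x ∈ Ioo c d, ∀ y ∈ Ioc 0 h0, (x, y) ∈ O' := fun x hx y hy =>
    ⟨hsub x ⟨hx.1.le, hx.2.le⟩ y hy, hmemS x hx y hy⟩
  set g : ℝ × ℝ → ℝ := fun p => V p - U p with hg
  set Q : ℝ × ℝ → ℝ := fun p => R p - P p with hQdef
  have hg1 : ContDiffOn ℝ 1 g O' :=
    ((hV.cd.mono inter_subset_right).sub (h.cd.mono inter_subset_left)).of_le (by norm_num)
  have hQ2 : ContDiffOn ℝ 2 Q O' :=
    (hV.cdP.mono inter_subset_right).sub (h.cdP.mono inter_subset_left)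
  have hφ := th_comp_contDiffOn hg1
  have dU : ∀ p ∈ O', DifferentiableAt ℝ U p := fun p hp =>
    diffAt_of h.op (h.cd.of_le (by norm_num)) hp.1
  have dV : ∀ p ∈ O', DifferentiableAt ℝ V p := fun p hp =>
    diffAt_of hV.op (hV.cd.of_le (by norm_num)) hp.2
  have gX : ∀ p ∈ O', dX g p = dX V p - dX U p := fun p hp => by
    unfold dX; rw [hg, fderiv_fun_sub (dV p hp) (dU p hp)]; simp
  have gY : ∀ p ∈ O', dY g p = dY V p - dY U p := fun p hp => by
    unfold dY; rw [hg, fderiv_fun_sub (dV p hp) (dU p hp)]; simp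
  have QX : ∀ p ∈ O', dX Q p = dX R p - dX P p := fun p hp => by
    unfold dX; rw [hQdef, fderiv_fun_sub (hV.diff p hp.2) (h.diff p hp.1)]; simp
  have QY : ∀ p ∈ O', dY Q p = dY R p - dY P p := fun p hp => by
    unfold dY; rw [hQdef, fderiv_fun_sub (hV.diff p hp.2) (h.diff p hp.1)]; simp
  set I : ℝ × ℝ → ℝ := fun p => dX (fun p => th (g p)) p * dY Q p - dY (fun p => th (g p)) p * dX Q p
    with hI
  have Icont : ContinuousOn I O' :=
    ((dX_continuousOn opO' hφ).mul (dY_contDiffOn opO' hQ2).continuousOn).sub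
      ((dY_continuousOn opO' hφ).mul (dX_contDiffOn opO' hQ2).continuousOn)
  have Ieq : ∀ p ∈ O', I p = thd (g p) * ((dX V p - dX U p) * (dX V p / WW V p - dX U p / WW U p) -
      (dY V p - dY U p) * (-dY V p / WW V p - -dY U p / WW U p)) := by
    intro p hp
    have dg := diffAt_of opO' hg1 hp
    have e1 : dX (fun p => th (g p)) p = thd (g p) * dX g p := by
      unfold dX; rw [th_comp_fderiv dg]
    have e2 : dY (fun p => th (g p)) p = thd (g p) * dY g p := by
      unfold dY; rw [th_comp_fderiv dg]
    simp only [hI]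
    rw [e1, e2, gX p hp, gY p hp, QX p hp, QY p hp, hV.dx p hp.2, hV.dy p hp.2, h.dx p hp.1,
      h.dy p hp.1]
    ring
  have M := fun p => mono_aux (dX V p) (dY V p) (dX U p) (dY U p) (WW V p) (WW U p)
    (WW_pos _ _) (WW_pos _ _) (WW_sq _ _) (WW_sq _ _)
  have Inn : ∀ p ∈ O', 0 ≤ I p := fun p hp => by
    rw [Ieq p hp]; exact mul_nonneg (thd_nonneg _) (M p).1
  -- the sign of `g` at the top
  have gtop : ∀ x ∈ Ioo c d, g (x, h0) ≤ 0 := by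
    intro x hx
    have h1 := hC x ⟨hx.1.le, hx.2.le⟩
    have h2 : V (x, h0) ≤ -C := by
      simp only [hVdef, skU, hh, Real.sin_pi_div_two, Real.log_one]
      have : Real.log (Real.sin (k * (x - c))) ≤ 0 := by
        have hm := (hmemS x hx h0 ⟨hh0, le_rfl⟩).1
        exact Real.log_nonpos (Real.sin_pos_of_pos_of_lt_pi hm.1 hm.2).le (Real.sin_le_one _)
      have := div_nonpos_of_nonpos_of_nonneg this hk.le
      simp only [sub_zero]; linarith
    simp only [hg]; linarith
  -- Step 1
  have step1 : ∀ η ∈ Ioo 0 h0, ∀ᶠ δ in 𝓝[>] (0:ℝ),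
      ∫ p in Icc (c + δ, η) (d - δ, h0), I p ≤ (d - c) - (P (d, η) - P (c, η)) := by
    intro η hη
    obtain ⟨B, hB⟩ : ∃ B, ∀ p ∈ Icc (c, η) (d, h0), B ≤ U p := by
      obtain ⟨A, hA⟩ := (isCompact_Icc.image_of_continuousOn (h.cd.continuousOn.mono (by
        rintro ⟨x, y⟩ hp
        exact hsub x ⟨hp.1.1, hp.2.1⟩ y ⟨hη.1.trans_le hp.1.2, hp.2.2⟩ :
          Icc (c, η) (d, h0) ⊆ O))).bddBelow
      exact ⟨A, fun p hp => hA ⟨p, hp, rfl⟩⟩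
    filter_upwards [scherk_sides hk hd hh hη.1 C B,
      Ioo_mem_nhdsGT (show (0:ℝ) < (d - c) / 2 by linarith)] with δ hδ hδ2
    have hδ3 : c + δ ≤ d - δ := by linarith [hδ2.2]
    have hxx : ∀ x ∈ Icc (c + δ) (d - δ), x ∈ Ioo c d := fun x hx =>
      ⟨by linarith [hx.1, hδ2.1], by linarith [hx.2, hδ2.1]⟩
    have hbox : Icc (c + δ, η) (d - δ, h0) ⊆ O' := by
      rintro ⟨x, y⟩ hp
      exact hmem x (hxx x ⟨hp.1.1, hp.2.1⟩) y ⟨hη.1.trans_le hp.1.2, hp.2.2⟩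
    have G := green opO' hφ hQ2 hδ3 hη.2.le hbox
    have T : ∫ x in (c + δ)..(d - δ), th (g (x, h0)) * dX Q (x, h0) = 0 := by
      rw [intervalIntegral.integral_congr (g := fun _ => (0:ℝ))]
      · simp
      · intro x hx
        rw [uIcc_of_le hδ3] at hx
        have := gtop x (hxx x hx)
        beta_reduce
        rw [th_zero this, zero_mul]
    have S1 : ∫ y in η..h0, th (g (d - δ, y)) * dY Q (d - δ, y) = 0 := by
      rw [intervalIntegral.integral_congr (g := fun _ => (0:ℝ))]
      · simp
      · intro y hy
        rw [uIcc_of_le hη.2.le] at hy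
        have h1 := (hδ y hy).2
        have h2 := hB (d - δ, y) ⟨⟨by simp only []; linarith [hδ2.1], hy.1⟩,
          ⟨by simp only []; linarith [hδ2.1], hy.2⟩⟩
        beta_reduce
        rw [th_zero (by simp only [hg]; linarith), zero_mul]
    have S2 : ∫ y in η..h0, th (g (c + δ, y)) * dY Q (c + δ, y) = 0 := by
      rw [intervalIntegral.integral_congr (g := fun _ => (0:ℝ))]
      · simp
      · intro y hy
        rw [uIcc_of_le hη.2.le] at hy
        have h1 := (hδ y hy).1
        have h2 := hB (c + δ, y) ⟨⟨by simp only []; linarith [hδ2.1], hy.1⟩,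
          ⟨by simp only []; linarith [hδ2.1], hy.2⟩⟩
        beta_reduce
        rw [th_zero (by simp only [hg]; linarith), zero_mul]
    have hbot : ∀ x ∈ Icc (c + δ) (d - δ), (x, η) ∈ O' := fun x hx =>
      hmem x (hxx x hx) η ⟨hη.1, hη.2.le⟩
    have hbotO : ∀ x ∈ Icc c d, (x, η) ∈ O := fun x hx => hsub x hx η ⟨hη.1, hη.2.le⟩
    have hcontd : ContinuousOn (fun x => 1 - dX P (x, η)) (Icc c d) :=
      continuousOn_const.sub ((dX_contDiffOn h.op h.cdP).continuousOn.comp (by fun_prop) hbotO)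
    have B1 : ∫ x in (c + δ)..(d - δ), th (g (x, η)) * dX Q (x, η) ≤
        ∫ x in (c + δ)..(d - δ), (1 - dX P (x, η)) := by
      refine intervalIntegral.integral_mono_on hδ3 ?_ ?_ fun x hx => ?_
      · refine ContinuousOn.intervalIntegrable ?_
        rw [uIcc_of_le hδ3]
        exact (hφ.continuousOn.mul (dX_contDiffOn opO' hQ2).continuousOn).comp (by fun_prop) hbot
      · refine ContinuousOn.intervalIntegrable ?_
        rw [uIcc_of_le hδ3]
        exact hcontd.mono fun x hx => Ioo_subset_Icc_self (hxx x hx)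
      · have hp := hbot x hx
        rw [QX _ hp]
        have h2 := (abs_le.1 (h.abs_dx_le hp.1)).2
        have h3 := (abs_le.1 (hV.abs_dx_le hp.2)).2
        have t0 := th_nonneg (g (x, η))
        have t1 := th_le_one (g (x, η))
        nlinarith
    have B2 : ∫ x in (c + δ)..(d - δ), (1 - dX P (x, η)) ≤ ∫ x in c..d, (1 - dX P (x, η)) := by
      refine intervalIntegral.integral_mono_interval (by linarith [hδ2.1]) hδ3
        (by linarith [hδ2.1]) ?_ ?_
      · refine (MeasureTheory.ae_restrict_iff' measurableSet_Ioc).2 (Eventually.of_forall ?_)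
        intro x hx
        have h2 := (abs_le.1 (h.abs_dx_le (hbotO x ⟨hx.1.le, hx.2⟩))).2
        simp only [Pi.zero_apply]; linarith
      · refine ContinuousOn.intervalIntegrable ?_
        rwa [uIcc_of_le hcd.le]
    rw [h.integral_defect hcd.le hbotO] at B2
    rw [T, S1, S2] at G
    rw [G]
    linarith
  -- Step 2
  have step2 : ∀ x ∈ Ioo c d, ∀ y ∈ Ioo 0 h0, I (x, y) ≤ 0 := by
    intro x hx y hy
    by_contra hpos
    push Not at hpos
    have hpO := hmem x hx y ⟨hy.1, hy.2.le⟩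
    have hnb : ∀ᶠ q in 𝓝 (x, y), I (x, y) / 2 < I q ∧ q ∈ Ioo c d ×ˢ Ioo 0 h0 := by
      refine ((Icont.continuousAt (opO'.mem_nhds hpO)).eventually
        (lt_mem_nhds (half_lt_self hpos))).and ?_
      exact (isOpen_Ioo.prod isOpen_Ioo).mem_nhds ⟨hx, hy⟩
    obtain ⟨r, hr, hball⟩ := Metric.eventually_nhds_iff_ball.1 hnb
    set ρ := r / 2 with hρ
    have hρ0 : 0 < ρ := by positivity
    have hbx : ∀ q ∈ Icc (x - ρ, y - ρ) (x + ρ, y + ρ),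
        I (x, y) / 2 < I q ∧ q ∈ Ioo c d ×ˢ Ioo 0 h0 := by
      rintro ⟨q1, q2⟩ ⟨⟨h1, h2⟩, ⟨h3, h4⟩⟩
      apply hball
      rw [Metric.mem_ball, Prod.dist_eq, max_lt_iff, Real.dist_eq, Real.dist_eq, abs_lt, abs_lt]
      simp only [] at h1 h2 h3 h4 ⊢
      refine ⟨⟨?_, ?_⟩, ⟨?_, ?_⟩⟩ <;> linarith
    have c1 := (hbx (x - ρ, y - ρ) ⟨le_rfl, ⟨by simp only []; linarith, by simp only []; linarith⟩⟩).2
    have c2 := (hbx (x + ρ, y + ρ) ⟨⟨by simp only []; linarith, by simp only []; linarith⟩, le_rfl⟩).2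
    have low : ∀ᶠ η in 𝓝[>] (0:ℝ),
        I (x, y) / 2 * ((2 * ρ) * (2 * ρ)) ≤ (d - c) - (P (d, η) - P (c, η)) := by
      have hyr : 0 < y - ρ := c1.2.1
      filter_upwards [Ioo_mem_nhdsGT hyr] with η hη
      have hηh : η ∈ Ioo 0 h0 := ⟨hη.1, by linarith [hη.2, hy.2]⟩
      have hev : ∀ᶠ δ in 𝓝[>] (0:ℝ), δ ∈ Ioo 0 (min (x - ρ - c) (d - (x + ρ))) :=
        Ioo_mem_nhdsGT (lt_min (by have := c1.1.1; simp only [] at this; linarith)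
          (by have := c2.1.2; simp only [] at this; linarith))
      obtain ⟨δ, hδ1, hδ2⟩ := ((step1 η hηh).and hev).exists
      have d1 := hδ2.2.trans_le (min_le_left _ _)
      have d2 := hδ2.2.trans_le (min_le_right _ _)
      have hbox : Icc (c + δ, η) (d - δ, h0) ⊆ O' := by
        rintro ⟨x, y⟩ hp
        exact hmem x ⟨by have := hp.1.1; simp only [] at this; linarith [hδ2.1],
          by have := hp.2.1; simp only [] at this; linarith [hδ2.1]⟩ y ⟨hη.1.trans_le hp.1.2, hp.2.2⟩
      have hsubbox : Icc (x - ρ, y - ρ) (x + ρ, y + ρ) ⊆ Icc (c + δ, η) (d - δ, h0) := by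
        have := c2.2.2
        refine Icc_subset_Icc ⟨?_, ?_⟩ ⟨?_, ?_⟩ <;> simp only [] at this ⊢ <;> linarith [hη.2]
      refine le_trans ?_ hδ1
      calc I (x, y) / 2 * ((2 * ρ) * (2 * ρ))
          = ∫ _p in Icc (x - ρ, y - ρ) (x + ρ, y + ρ), I (x, y) / 2 := by
            rw [MeasureTheory.setIntegral_const, volume_real_box (by linarith) (by linarith),
              smul_eq_mul]; ring
        _ ≤ ∫ p in Icc (x - ρ, y - ρ) (x + ρ, y + ρ), I p := by
            refine MeasureTheory.setIntegral_mono_on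
              (continuousOn_const.integrableOn_compact isCompact_Icc)
              ((Icont.mono (hsubbox.trans hbox)).integrableOn_compact isCompact_Icc)
              measurableSet_Icc fun p hp => (hbx p hp).1.le
        _ ≤ ∫ p in Icc (c + δ, η) (d - δ, h0), I p := by
            refine MeasureTheory.setIntegral_mono_set
              ((Icont.mono hbox).integrableOn_compact isCompact_Icc) ?_
              hsubbox.eventuallyLE
            exact (MeasureTheory.ae_restrict_iff' measurableSet_Icc).2
              (Eventually.of_forall fun p hp => Inn p (hbox hp))
    have := ge_of_tendsto (tendsto_const_nhds.sub hl) low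
    rw [sub_self] at this
    have : 0 < I (x, y) / 2 * ((2 * ρ) * (2 * ρ)) := by positivity
    linarith
  -- Step 3
  intro x hx y hy
  by_contra hcon
  push Not at hcon
  have hgy : 0 < g (x, y) := by simp only [hg]; linarith
  have hcolO : ∀ s ∈ Icc y h0, (x, s) ∈ O' := fun s hs => hmem x hx s ⟨hy.1.trans_le hs.1, hs.2⟩
  have hfc : ContinuousOn (fun s => g (x, s)) (Icc y h0) :=
    hg1.continuousOn.comp (by fun_prop) hcolO
  set Z := {s ∈ Icc y h0 | g (x, s) ≤ 0} with hZ
  have Zcl : IsClosed Z := hfc.preimage_isClosed_of_isClosed isClosed_Icc isClosed_Iic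
  have Zne : Z.Nonempty := ⟨h0, ⟨hy.2, le_rfl⟩, gtop x hx⟩
  have Zbd : BddBelow Z := ⟨y, fun s hs => hs.1.1⟩
  have hs0 := Zcl.csInf_mem Zne Zbd
  set s0 := sInf Z
  have hbelow : ∀ s ∈ Ico y s0, 0 < g (x, s) := by
    intro s hs
    by_contra hn
    push Not at hn
    have : s ∈ Z := ⟨⟨hs.1, hs.2.le.trans hs0.1.2⟩, hn⟩
    exact absurd (csInf_le Zbd this) (not_le.2 hs.2)
  have hconst := constant_of_has_deriv_right_zero (f := fun s => g (x, s)) (a := y) (b := s0)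
    (hfc.mono (Icc_subset_Icc_right hs0.1.2)) (by
      intro s hs
      have hsO := hcolO s ⟨hs.1, hs.2.le.trans hs0.1.2⟩
      have hder := hasDerivAt_col (diffAt_of opO' hg1 hsO)
      have hI0 := step2 x hx s ⟨hy.1.trans_le hs.1, hs.2.trans_le hs0.1.2⟩
      rw [Ieq _ hsO] at hI0
      have ht := thd_pos (hbelow s hs)
      have h2 := (M (x, s)).2 (nonpos_of_mul_nonpos_right hI0 ht)
      have : dY g (x, s) = 0 := by rw [gY _ hsO, h2.2, sub_self]
      rw [this] at hder
      exact hder.hasDerivWithinAt) s0 ⟨hs0.1.1, le_rfl⟩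
  have := hs0.2
  linarith

/-! ### Transfer to adapted coordinates -/

/-- Coordinates adapted to a boundary segment. -/
def Ph (a e : Pt) (p : ℝ × ℝ) : Pt := a + (p.1 • e + p.2 • vec2 (-(e 1)) (e 0))

lemma vec2_zero (x y : ℝ) : vec2 x y 0 = x := rfl
lemma vec2_one (x y : ℝ) : vec2 x y 1 = y := rfl

lemma inner_pt (x y : Pt) : ⟪x, y⟫ = x 0 * y 0 + x 1 * y 1 := by
  simp [PiLp.inner_apply, Fin.sum_univ_two, mul_comm]

lemma normsq_pt (x : Pt) : ‖x‖ ^ 2 = x 0 ^ 2 + x 1 ^ 2 := by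
  rw [EuclideanSpace.norm_sq_eq]; simp [Fin.sum_univ_two]

/-- linear part of `Ph` -/
def PhL (e : Pt) : ℝ × ℝ →L[ℝ] Pt :=
  (ContinuousLinearMap.fst ℝ ℝ ℝ).smulRight e +
    (ContinuousLinearMap.snd ℝ ℝ ℝ).smulRight (vec2 (-(e 1)) (e 0))

lemma Ph_hasFDerivAt (a e : Pt) (p : ℝ × ℝ) : HasFDerivAt (Ph a e) (PhL e) p := by
  have : Ph a e = fun p => a + PhL e p := by funext p; simp [Ph, PhL]
  rw [this]
  exact (PhL e).hasFDerivAt.const_add a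

lemma Ph_continuous (a e : Pt) : Continuous (Ph a e) := by unfold Ph; fun_prop

lemma Ph_contDiff (a e : Pt) : ContDiff ℝ 2 (Ph a e) := by unfold Ph; fun_prop

lemma transfer {Ω : Set Pt} (hΩ : IsOpen Ω) {u ψ : Pt → ℝ} (hu : ContDiffOn ℝ 2 u Ω)
    (hψ : IsConjugate Ω u ψ) (a e : Pt) (he : e 0 ^ 2 + e 1 ^ 2 = 1) :
    CPair (Ph a e ⁻¹' Ω) (fun p => u (Ph a e p)) (fun p => ψ (Ph a e p)) := by
  have du : ∀ p, Ph a e p ∈ Ω → DifferentiableAt ℝ u (Ph a e p) := fun p hp =>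
    ((hu _ hp).contDiffAt (hΩ.mem_nhds hp)).differentiableAt (by norm_num)
  have chain : ∀ f : Pt → ℝ, ∀ p, DifferentiableAt ℝ f (Ph a e p) →
      HasFDerivAt (fun p => f (Ph a e p)) ((fderiv ℝ f (Ph a e p)).comp (PhL e)) p :=
    fun f p hf => hf.hasFDerivAt.comp p (Ph_hasFDerivAt a e p)
  have cX : ∀ f : Pt → ℝ, ∀ p, DifferentiableAt ℝ f (Ph a e p) →
      dX (fun p => f (Ph a e p)) p =
        gradient f (Ph a e p) 0 * e 0 + gradient f (Ph a e p) 1 * e 1 := by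
    intro f p hf
    unfold dX
    rw [(chain f p hf).fderiv, ← inner_pt, inner_gradient_left]
    simp [PhL]
  have cY : ∀ f : Pt → ℝ, ∀ p, DifferentiableAt ℝ f (Ph a e p) →
      dY (fun p => f (Ph a e p)) p =
        gradient f (Ph a e p) 0 * -(e 1) + gradient f (Ph a e p) 1 * e 0 := by
    intro f p hf
    have : gradient f (Ph a e p) 0 * -(e 1) + gradient f (Ph a e p) 1 * e 0 =
      ⟪gradient f (Ph a e p), vec2 (-(e 1)) (e 0)⟫ := by rw [inner_pt, vec2_zero, vec2_one]
    unfold dY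
    rw [(chain f p hf).fderiv, this, inner_gradient_left]
    simp [PhL]
  have cW : ∀ p, Ph a e p ∈ Ω → WW (fun p => u (Ph a e p)) p = Wu u (Ph a e p) := by
    intro p hp
    unfold WW Wu
    rw [cX u p (du p hp), cY u p (du p hp), normsq_pt]
    congr 1
    linear_combination (gradient u (Ph a e p) 0 ^ 2 + gradient u (Ph a e p) 1 ^ 2) * he
  refine ⟨hΩ.preimage (Ph_continuous a e), ?_, ?_, ?_, ?_⟩
  · exact hu.comp (Ph_contDiff a e).contDiffOn fun p hp => hp
  · intro p hp
    exact (chain ψ p (hψ _ hp).1).differentiableAt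
  · intro p hp
    rw [cX ψ p (hψ _ hp).1, cY u p (du p hp), cW p hp, (hψ _ hp).2]
    simp only [conjField, PiLp.smul_apply, vec2_zero, vec2_one, smul_eq_mul]
    ring
  · intro p hp
    rw [cY ψ p (hψ _ hp).1, cX u p (du p hp), cW p hp, (hψ _ hp).2]
    simp only [conjField, PiLp.smul_apply, vec2_zero, vec2_one, smul_eq_mul]
    ring

lemma conj_lipschitz {Ω : Set Pt} (hconv : Convex ℝ Ω) {u ψ ψb : Pt → ℝ}
    (hψ : IsConjugate Ω u ψ) (hψb : ContinuousOn ψb (closure Ω)) (hext : EqOn ψb ψ Ω)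
    {x y : Pt} (hx : x ∈ closure Ω) (hy : y ∈ closure Ω) : |ψb x - ψb y| ≤ ‖x - y‖ := by
  have h1 : LipschitzOnWith 1 ψ Ω := by
    refine hconv.lipschitzOnWith_of_nnnorm_fderiv_le (fun p hp => (hψ p hp).1) fun p hp => ?_
    rw [← NNReal.coe_le_coe, coe_nnnorm, ← toDual_gradient, LinearIsometryEquiv.norm_map,
      (hψ p hp).2]
    have hW : 0 < Wu u p := by unfold Wu; positivity
    have hW2 : Wu u p ^ 2 = 1 + ‖gradient u p‖ ^ 2 := by
      unfold Wu; rw [Real.sq_sqrt (by positivity)]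
    have hn : ‖vec2 (-(gradient u p 1)) (gradient u p 0)‖ ≤ Wu u p := by
      refine (abs_le_of_sq_le_sq' ?_ hW.le).2
      rw [normsq_pt, vec2_zero, vec2_one, hW2, normsq_pt]; linarith
    unfold conjField
    rw [norm_smul, norm_inv, Real.norm_eq_abs, abs_of_pos hW, NNReal.coe_one,
      inv_mul_le_iff₀ hW]
    linarith
  have h2 : LipschitzOnWith 1 ψb Ω := fun x hx y hy => by
    rw [hext hx, hext hy]; exact h1 hx hy
  have := (h2.closure hψb).dist_le_mul x hx y hy
  simpa [Real.dist_eq, dist_eq_norm] using this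

lemma scherk_tendsto {k c s : ℝ} (hk : 0 < k) (hs : k * (s - c) = Real.pi / 2) (C : ℝ) :
    Tendsto (skU k c C) (𝓝 s ×ˢ 𝓝[>] 0) atTop := by
  have h1 : Tendsto (fun p : ℝ × ℝ => Real.log (Real.sin (k * (p.1 - c)))) (𝓝 s ×ˢ 𝓝[>] 0)
      (𝓝 0) := by
    have hc : ContinuousAt (fun x : ℝ => Real.log (Real.sin (k * (x - c)))) s := by
      refine ContinuousAt.log (by fun_prop) ?_
      rw [hs]; simp
    have := hc.tendsto
    rw [hs, Real.sin_pi_div_two, Real.log_one] at this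
    exact this.comp tendsto_fst
  have h2 : Tendsto (fun p : ℝ × ℝ => Real.log (Real.sin (k * p.2))) (𝓝 s ×ˢ 𝓝[>] 0) atBot := by
    have h1 : Tendsto (fun δ : ℝ => Real.sin (k * δ)) (𝓝[>] 0) (𝓝[>] 0) := by
      refine tendsto_nhdsWithin_iff.2 ⟨?_, ?_⟩
      · have : Continuous fun δ : ℝ => Real.sin (k * δ) := by fun_prop
        simpa using (this.tendsto 0).mono_left nhdsWithin_le_nhds
      · have : Ioo 0 (Real.pi / k) ∈ 𝓝[>] (0:ℝ) := Ioo_mem_nhdsGT (by positivity)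
        filter_upwards [this] with δ hδ
        refine Real.sin_pos_of_pos_of_lt_pi (mul_pos hk hδ.1) ?_
        have := hδ.2
        rw [lt_div_iff₀ hk] at this
        linarith
    exact (Real.tendsto_log_nhdsGT_zero.comp h1).comp tendsto_snd
  have h3 := h1.add_atTop (tendsto_neg_atBot_atTop.comp h2)
  have h4 := tendsto_atTop_add_const_right _ (-C) (h3.atTop_div_const hk)
  refine h4.congr fun p => ?_
  simp only [skU, Function.comp]
  ring

/-- The main equivalence for `+∞`. -/
lemma half {Ω : Set Pt} (hΩ : IsOpen Ω) (hconv : Convex ℝ Ω)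
    {u ψ ψb : Pt → ℝ} (hu : ContDiffOn ℝ 2 u Ω) (hψ : IsConjugate Ω u ψ)
    (hψb : ContinuousOn ψb (closure Ω)) (hext : EqOn ψb ψ Ω)
    {a b : Pt} (hab : a ≠ b) (ha : a ∈ frontier Ω) (hb : b ∈ frontier Ω)
    (hleft : ∀ x ∈ Ω, 0 < ⟪vec2 (-((b - a) 1)) ((b - a) 0), x - a⟫) :
    ψb b - ψb a = ‖b - a‖ ↔ ∀ t ∈ openSegment ℝ a b, Tendsto u (𝓝[Ω] t) atTop := by
  set L := ‖b - a‖ with hL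
  have hL0 : 0 < L := norm_pos_iff.2 (sub_ne_zero.2 hab.symm)
  set e : Pt := L⁻¹ • (b - a) with he
  have hbe : b - a = L • e := by rw [he, smul_inv_smul₀ hL0.ne']
  have hen : ‖e‖ = 1 := by
    rw [he, norm_smul, norm_inv, Real.norm_eq_abs, abs_of_pos hL0]
    exact inv_mul_cancel₀ hL0.ne'
  have he1 : e 0 ^ 2 + e 1 ^ 2 = 1 := by rw [← normsq_pt, hen]; norm_num
  have haC : a ∈ closure Ω := frontier_subset_closure ha
  have hbC : b ∈ closure Ω := frontier_subset_closure hb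
  have hpair := transfer hΩ hu hψ a e he1
  set Φ := Ph a e with hΦ
  have Φc : Continuous Φ := Ph_continuous a e
  -- inverse coordinates
  set cx : Pt → ℝ := fun x => ⟪e, x - a⟫ with hcx
  set cy : Pt → ℝ := fun x => ⟪vec2 (-(e 1)) (e 0), x - a⟫ with hcy
  have Φinv : ∀ x, Φ (cx x, cy x) = x := by
    intro x
    ext i
    simp only [hΦ, Ph, hcx, hcy, inner_pt, vec2_zero, vec2_one, PiLp.add_apply, PiLp.smul_apply,
      smul_eq_mul, PiLp.sub_apply]
    fin_cases i
    · simp only [Fin.zero_eta, vec2_zero]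
      linear_combination (x 0 - a 0) * he1
    · simp only [Fin.mk_one, vec2_one]
      linear_combination (x 1 - a 1) * he1
  have hcypos : ∀ x ∈ Ω, 0 < cy x := by
    intro x hx
    have h1 := hleft x hx
    rw [hbe, inner_pt] at h1
    simp only [vec2_zero, vec2_one, PiLp.smul_apply, smul_eq_mul] at h1
    simp only [hcy]
    rw [inner_pt]
    simp only [vec2_zero, vec2_one]
    refine pos_of_mul_pos_right (a := L) ?_ hL0.le
    linarith
  have Φ0 : ∀ s, Φ (s, 0) = a + (s / L) • (b - a) := by
    intro s
    rw [hbe, smul_smul, div_mul_cancel₀ _ hL0.ne']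
    simp [hΦ, Ph]
  have Φ00 : Φ (0, 0) = a := by rw [Φ0]; simp
  have ΦL0 : Φ (L, 0) = b := by rw [Φ0, div_self hL0.ne']; simp
  have Φcl : ∀ s ∈ Icc 0 L, Φ (s, 0) ∈ closure Ω := by
    intro s hs
    rw [Φ0]
    exact hconv.closure.add_smul_sub_mem haC hbC
      ⟨div_nonneg hs.1 hL0.le, (div_le_one hL0).2 hs.2⟩
  -- rectangles
  have rect : ∀ c d, 0 < c → d < L → ∃ r > 0, ∀ x ∈ Icc c d, ∀ y ∈ Ioc 0 r, Φ (x, y) ∈ Ω := by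
    intro c d hc hd
    obtain ⟨x0, hx0⟩ : Ω.Nonempty := closure_nonempty_iff.1 ⟨a, haC⟩
    set q1 := cx x0
    set q2 := cy x0
    have hq2 : 0 < q2 := hcypos x0 hx0
    set ε := min (1 / 2) (min (c / (|q1| + 1)) ((L - d) / (L + |q1| + 1))) with hε
    have hε0 : 0 < ε := by
      refine lt_min (by norm_num) (lt_min (by positivity) (div_pos (by linarith) (by positivity)))
    refine ⟨q2 * ε, by positivity, fun x hx y hy => ?_⟩
    set lam := y / q2 with hlam
    have hl0 : 0 < lam := div_pos hy.1 hq2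
    have hlε : lam ≤ ε := by rw [hlam, div_le_iff₀ hq2, mul_comm]; exact hy.2
    have l1 : lam ≤ 1 / 2 := hlε.trans (min_le_left _ _)
    have l2 : lam * (|q1| + 1) ≤ c := by
      rw [← le_div_iff₀ (by positivity)]
      exact hlε.trans ((min_le_right _ _).trans (min_le_left _ _))
    have l3 : lam * (L + |q1| + 1) ≤ L - d := by
      rw [← le_div_iff₀ (by positivity)]
      exact hlε.trans ((min_le_right _ _).trans (min_le_right _ _))
    have l4 : 0 < 1 - lam := by linarith
    set x' := (x - lam * q1) / (1 - lam) with hx'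
    have b1 : lam * q1 ≤ lam * |q1| := mul_le_mul_of_nonneg_left (le_abs_self _) hl0.le
    have b2 : lam * -q1 ≤ lam * |q1| := mul_le_mul_of_nonneg_left (neg_le_abs _) hl0.le
    have hx'm : x' ∈ Icc 0 L := by
      constructor
      · exact div_nonneg (by linarith [hx.1]) l4.le
      · rw [hx', div_le_iff₀ l4]; linarith [hx.2]
    have hcomb := hconv.combo_interior_closure_mem_interior
      (by rw [hΩ.interior_eq]; exact hx0) (Φcl x' hx'm) hl0 l4.le (by ring : lam + (1 - lam) = 1)
    rw [hΩ.interior_eq] at hcomb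
    convert hcomb using 1
    have hxx : x = lam * q1 + (1 - lam) * x' := by rw [hx']; field_simp; ring
    have hyy : y = lam * q2 := by rw [hlam]; field_simp
    rw [← Φinv x0]
    change Φ (x, y) = lam • Φ (q1, q2) + (1 - lam) • Φ (x', 0)
    rw [hxx, hyy]
    simp only [hΦ, Ph]
    module
  -- boundary values
  set m : ℝ → ℝ := fun s => ψb (Φ (s, 0)) with hm
  have mlip : ∀ s ∈ Icc 0 L, ∀ t ∈ Icc 0 L, |m s - m t| ≤ |s - t| := by
    intro s hs t ht
    refine (conj_lipschitz hconv hψ hψb hext (Φcl s hs) (Φcl t ht)).trans (le_of_eq ?_)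
    have : Φ (s, 0) - Φ (t, 0) = (s - t) • e := by simp only [hΦ, Ph]; module
    rw [this, norm_smul, hen, Real.norm_eq_abs, mul_one]
  have mlim : ∀ s, 0 < s → s < L → Tendsto (fun y => ψ (Φ (s, y))) (𝓝[>] 0) (𝓝 (m s)) := by
    intro s hs0 hsL
    obtain ⟨r, hr, hrect⟩ := rect s s hs0 hsL
    have hev : ∀ᶠ y in 𝓝[>] (0:ℝ), Φ (s, y) ∈ Ω := by
      filter_upwards [Ioc_mem_nhdsGT hr] with y hy using hrect s ⟨le_rfl, le_rfl⟩ y hy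
    have h1 : Tendsto (fun y => Φ (s, y)) (𝓝[>] 0) (𝓝[closure Ω] (Φ (s, 0))) := by
      refine tendsto_nhdsWithin_iff.2 ⟨?_, hev.mono fun y hy => subset_closure hy⟩
      have : Continuous fun y => Φ (s, y) := by fun_prop
      exact (this.tendsto 0).mono_left nhdsWithin_le_nhds
    have h2 := (hψb _ (Φcl s ⟨hs0.le, hsL.le⟩)).tendsto.comp h1
    refine h2.congr' ?_
    filter_upwards [hev] with y hy using hext hy
  have ends : ψb b - ψb a = m L - m 0 := by simp only [hm, ΦL0, Φ00]
  have m0 : (0:ℝ) ∈ Icc 0 L := ⟨le_rfl, hL0.le⟩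
  have mL : L ∈ Icc 0 L := ⟨hL0.le, le_rfl⟩
  rw [ends]
  constructor
  · -- flux maximal implies divergence
    intro hflux t ht
    obtain ⟨θ, hθ, rfl⟩ : ∃ θ ∈ Ioo (0:ℝ) 1, a + θ • (b - a) = t := by
      rwa [openSegment_eq_image'] at ht
    set s := θ * L with hs
    have hs0 : 0 < s := mul_pos hθ.1 hL0
    have hsL : s < L := by rw [hs]; nlinarith [hθ.2]
    have hΦs : Φ (s, 0) = a + θ • (b - a) := by rw [Φ0, hs, mul_div_cancel_right₀ _ hL0.ne']
    rw [← hΦs]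
    set w := min s (L - s) / 2 with hw
    have hwpos : 0 < w := by
      have : 0 < min s (L - s) := lt_min hs0 (by linarith)
      positivity
    have w1 : w ≤ s / 2 := by rw [hw]; linarith [min_le_left s (L - s)]
    have w2 : w ≤ (L - s) / 2 := by rw [hw]; linarith [min_le_right s (L - s)]
    obtain ⟨r, hr, hrect⟩ := rect (s - w) (s + w) (by linarith) (by linarith)
    set ρ := min w r with hρ
    have hρ0 : 0 < ρ := lt_min hwpos hr
    have ρw : ρ ≤ w := min_le_left _ _
    have ρr : ρ ≤ r := min_le_right _ _
    set k := Real.pi / (2 * ρ) with hk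
    have hk0 : 0 < k := div_pos Real.pi_pos (by positivity)
    have hcI : s - ρ ∈ Icc 0 L := ⟨by linarith, by linarith⟩
    have hdI : s + ρ ∈ Icc 0 L := ⟨by linarith, by linarith⟩
    have hinc : m (s + ρ) - m (s - ρ) = (s + ρ) - (s - ρ) := by
      have i1 := (abs_le.1 (mlip _ mL _ hdI)).2
      have i2 := (abs_le.1 (mlip _ hcI _ m0)).2
      have i3 := (abs_le.1 (mlip _ hdI _ hcI)).2
      have i4 := mlip _ hdI _ hcI
      have i1' := mlip _ mL _ hdI
      have i2' := mlip _ hcI _ m0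
      rw [abs_of_nonneg (by linarith : (0:ℝ) ≤ L - (s + ρ))] at i1'
      rw [abs_of_nonneg (by linarith : (0:ℝ) ≤ s - ρ - 0)] at i2'
      rw [abs_of_nonneg (by linarith : (0:ℝ) ≤ s + ρ - (s - ρ))] at i4
      have j1 := (abs_le.1 i1').2
      have j2 := (abs_le.1 i2').2
      have j3 := (abs_le.1 i4).2
      linarith
    have hlim := (mlim (s + ρ) (by linarith) (by linarith)).sub
      (mlim (s - ρ) (by linarith) (by linarith))
    rw [hinc] at hlim
    obtain ⟨C, hC⟩ := coreA hpair (k := k) (c := s - ρ) (d := s + ρ) (h0 := ρ) hk0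
      (by rw [hk]; field_simp; ring) (by rw [hk]; field_simp)
      (fun x hx y hy => hrect x ⟨by linarith [hx.1], by linarith [hx.2]⟩ y ⟨hy.1, hy.2.trans ρr⟩)
      hlim
    have hsc := scherk_tendsto (k := k) (c := s - ρ) (s := s) hk0
      (by rw [hk]; field_simp; ring) C
    have cxΦ : cx (Φ (s, 0)) = s := by
      simp only [hcx, hΦ, Ph, inner_pt, PiLp.add_apply, PiLp.sub_apply, PiLp.smul_apply, smul_eq_mul]
      linear_combination s * he1
    have cyΦ : cy (Φ (s, 0)) = 0 := by
      simp only [hcy, hΦ, Ph, inner_pt, PiLp.add_apply, PiLp.sub_apply, PiLp.smul_apply,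
        smul_eq_mul, vec2_zero, vec2_one]
      ring
    have tx : Tendsto cx (𝓝[Ω] (Φ (s, 0))) (𝓝 s) := by
      have : Continuous cx := by simp only [hcx]; fun_prop
      have h1 := this.tendsto (Φ (s, 0))
      rw [cxΦ] at h1
      exact h1.mono_left nhdsWithin_le_nhds
    have ty : Tendsto cy (𝓝[Ω] (Φ (s, 0))) (𝓝[>] 0) := by
      refine tendsto_nhdsWithin_iff.2 ⟨?_, ?_⟩
      · have : Continuous cy := by simp only [hcy]; fun_prop
        have h1 := this.tendsto (Φ (s, 0))
        rw [cyΦ] at h1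
        exact h1.mono_left nhdsWithin_le_nhds
      · filter_upwards [self_mem_nhdsWithin] with x hx using hcypos x hx
    have hfin := hsc.comp (tx.prodMk ty)
    refine tendsto_atTop_mono' _ ?_ hfin
    filter_upwards [tx.eventually (Ioo_mem_nhds (by linarith : s - ρ < s) (by linarith : s < s + ρ)),
      ty.eventually (Ioc_mem_nhdsGT hρ0)] with x h1 h2
    have := hC (cx x) h1 (cy x) h2
    rw [Φinv] at this
    exact this
  · -- divergence implies maximal flux
    intro hdiv
    have hstep : ∀ c ∈ Ioo 0 (L / 2), L - 4 * c ≤ m L - m 0 := by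
      intro c hc
      have hcd : c < L - c := by linarith [hc.2]
      obtain ⟨r, hr, hrect⟩ := rect c (L - c) hc.1 (by linarith [hc.1])
      have hB := coreB hpair hcd hr hrect (by
        intro A
        have hev : ∀ᶠ y in 𝓝 (0:ℝ), ∀ x ∈ Icc c (L - c), (Φ (x, y) ∈ Ω → A ≤ u (Φ (x, y))) := by
          refine isCompact_Icc.eventually_forall_of_forall_eventually fun x hx => ?_
          have hxs : Φ (x, 0) ∈ openSegment ℝ a b := by
            rw [openSegment_eq_image', Φ0]
            exact ⟨x / L, ⟨div_pos (by linarith [hx.1, hc.1]) hL0,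
              (div_lt_one hL0).2 (by linarith [hx.2, hc.1])⟩, rfl⟩
          have h1 := eventually_nhdsWithin_iff.1 ((hdiv _ hxs).eventually_ge_atTop A)
          have h2 : Continuous fun z : ℝ × ℝ => Φ (z.2, z.1) := by fun_prop
          exact (h2.tendsto (0, x)).eventually h1
        obtain ⟨ε, hε, hball⟩ := Metric.eventually_nhds_iff_ball.1 hev
        refine ⟨min ε r, lt_min hε hr, fun y hy x hx => ?_⟩
        have y1 := hy.2.trans_le (min_le_left _ _)
        have y2 := hy.2.trans_le (min_le_right _ _)
        refine hball y ?_ x hx (hrect x hx y ⟨hy.1, y2.le⟩)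
        rw [Metric.mem_ball, Real.dist_eq, sub_zero, abs_of_pos hy.1]
        exact y1)
        ((mlim (L - c) (by linarith [hc.2]) (by linarith [hc.1])).sub
          (mlim c hc.1 (by linarith [hc.2])))
      have cI : c ∈ Icc 0 L := ⟨hc.1.le, by linarith [hc.2]⟩
      have dI : L - c ∈ Icc 0 L := ⟨by linarith [hc.2], by linarith [hc.1]⟩
      have i1 := mlip _ mL _ dI
      have i2 := mlip _ cI _ m0
      rw [abs_of_nonneg (by linarith [hc.1] : (0:ℝ) ≤ L - (L - c))] at i1
      rw [abs_of_nonneg (by linarith [hc.1] : (0:ℝ) ≤ c - 0)] at i2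
      have j1 := (abs_le.1 i1).1
      have j2 := (abs_le.1 i2).1
      linarith
    have hge : L ≤ m L - m 0 := by
      have hcont : Continuous fun c : ℝ => L - 4 * c := by fun_prop
      have h1 : Tendsto (fun c : ℝ => L - 4 * c) (𝓝[>] 0) (𝓝 L) := by
        simpa using (hcont.tendsto 0).mono_left nhdsWithin_le_nhds
      exact le_of_tendsto h1 (by
        filter_upwards [Ioo_mem_nhdsGT (by positivity : (0:ℝ) < L / 2)] with c hc using hstep c hc)
    have hle := mlip _ mL _ m0
    rw [abs_of_nonneg (by linarith : (0:ℝ) ≤ L - 0)] at hle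
    have := (abs_le.1 hle).2
    linarith

lemma gradient_neg' (f : Pt → ℝ) (p : Pt) : gradient (fun x => -f x) p = -gradient f p := by
  unfold gradient
  rw [fderiv_fun_neg, map_neg]

lemma isConjugate_neg {Ω : Set Pt} {u ψ : Pt → ℝ} (hψ : IsConjugate Ω u ψ) :
    IsConjugate Ω (fun x => -u x) (fun x => -ψ x) := by
  intro p hp
  refine ⟨(hψ p hp).1.neg, ?_⟩
  rw [gradient_neg', (hψ p hp).2]
  unfold conjField Wu
  rw [gradient_neg', norm_neg, ← smul_neg]
  congr 1
  ext i
  fin_cases i <;> simp [vec2]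

/-- Lemma 1 (ii): for a boundary segment `T = (a, b)` of a convex domain, oriented so that
`Ω` lies to the left of `b − a`, the increment of the extended conjugate function satisfies
`|ψ̄(b) − ψ̄(a)| ≤ ‖b − a‖`, with equality `+‖b − a‖` (resp. `−‖b − a‖`) exactly when `u`
diverges to `+∞` (resp. `−∞`) on approaching `T` within `Ω`. -/
theorem flux_along_boundary_segment
    (Ω : Set Pt) (hΩ : IsOpen Ω) (hconv : Convex ℝ Ω)
    (u ψ ψb : Pt → ℝ) (hu : MinimalGraph Ω u) (hψ : IsConjugate Ω u ψ)
    (hψb : ContinuousOn ψb (closure Ω)) (hext : EqOn ψb ψ Ω)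
    (a b : Pt) (hab : a ≠ b)
    (ha : a ∈ frontier Ω) (hb : b ∈ frontier Ω)
    (hT : openSegment ℝ a b ⊆ frontier Ω)
    (hleft : ∀ x ∈ Ω, 0 < ⟪vec2 (-((b - a) 1)) ((b - a) 0), x - a⟫) :
    (ψb b - ψb a = ‖b - a‖ ↔
        ∀ t ∈ openSegment ℝ a b, Tendsto u (𝓝[Ω] t) atTop) ∧
    (ψb b - ψb a = -‖b - a‖ ↔
        ∀ t ∈ openSegment ℝ a b, Tendsto u (𝓝[Ω] t) atBot) ∧
    |ψb b - ψb a| ≤ ‖b - a‖ := by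
  have haC := frontier_subset_closure ha
  have hbC := frontier_subset_closure hb
  refine ⟨half hΩ hconv hu.2.1 hψ hψb hext hab ha hb hleft, ?_,
    conj_lipschitz hconv hψ hψb hext hbC haC⟩
  have h := half hΩ hconv hu.2.1.neg (isConjugate_neg hψ) hψb.neg
    (fun x hx => by simp [hext hx]) hab ha hb hleft
  simp only [tendsto_neg_atTop_iff, Pi.neg_apply] at h
  rw [← h]
  constructor <;> intro h' <;> linarith
end
end

section
/- Let Ω ⊆ ℝ² be a bounded open set, u : Ω → ℝ a minimal graph on Ω, and ψ̄ : closure(Ω) → ℝ a continuous function which is differentiable on Ω with ∇ψ̄ = F_u on Ω. Then for every p ∈ Ω one has inf_{x ∈ ∂Ω} ψ̄(x) ≤ ψ̄(p) ≤ sup_{x ∈ ∂Ω} ψ̄(x). In particular, if 0 ≤ ψ̄ ≤ 1 on ∂Ω then 0 ≤ ψ̄ ≤ 1 on Ω. -/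
open Set Filter Topology Metric
open scoped RealInnerProductSpace

noncomputable section

lemma local_max_second {φ φ' : ℝ → ℝ} {d : ℝ} (h1 : ∀ᶠ t in 𝓝 (0:ℝ), HasDerivAt φ (φ' t) t)
    (h2 : HasDerivAt φ' d 0) (hmax : IsLocalMax φ 0) : d ≤ 0 := by
  by_contra hd
  push Not at hd
  have e1 : deriv φ =ᶠ[𝓝 0] φ' := h1.mono fun t ht => ht.deriv
  have hdd : deriv (deriv φ) 0 = d := by rw [e1.deriv_eq, h2.deriv]
  have h0 : deriv φ 0 = 0 := hmax.deriv_eq_zero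
  have hmin : IsLocalMin φ 0 := isLocalMin_of_deriv_deriv_pos (by rw [hdd]; exact hd) h0
    h1.self_of_nhds.continuousAt
  have hc : φ =ᶠ[𝓝 0] fun _ => φ 0 := by
    filter_upwards [hmax, hmin] with t a b using le_antisymm a b
  have h3 : deriv φ =ᶠ[𝓝 0] fun _ => 0 := by
    have := hc.deriv
    simpa using this
  have h4 := h3.deriv_eq
  rw [hdd] at h4
  simp at h4
  linarith

lemma grad_coord (u : Pt → ℝ) (p : Pt) (i : Fin 2) :
    gradient u p i = fderiv ℝ u p (EuclideanSpace.single i 1) := by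
  have h : fderiv ℝ u p (EuclideanSpace.single i 1)
      = inner ℝ (gradient u p) (EuclideanSpace.single i (1:ℝ)) := by
    simp [gradient]
  rw [h, EuclideanSpace.inner_single_right]
  simp

lemma Wu_eq (u : Pt → ℝ) (p : Pt) :
    Wu u p = Real.sqrt (1 + (gradient u p 0) ^ 2 + (gradient u p 1) ^ 2) := by
  unfold Wu
  rw [EuclideanSpace.real_norm_sq_eq, Fin.sum_univ_two, add_assoc]

lemma no_interior_max (Ω : Set Pt) (hΩ : IsOpen Ω) (u ψ : Pt → ℝ) (hu : ContDiffOn ℝ 2 u Ω)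
    (hgrad : ∀ p ∈ Ω, DifferentiableAt ℝ ψ p ∧ gradient ψ p = conjField u p)
    (s ε : ℝ) (hε : 0 < ε) (p : Pt) (hp : p ∈ Ω)
    (hmax : IsLocalMax (fun q => s * ψ q + ε * ‖q‖ ^ 2) p) : False := by
  set E0 : Pt := EuclideanSpace.single 0 1 with hE0
  set E1 : Pt := EuclideanSpace.single 1 1 with hE1
  have hcd : ContDiffAt ℝ 2 u p := hu.contDiffAt (hΩ.mem_nhds hp)
  set A := fderiv ℝ (fderiv ℝ u) p with hA
  have hAd : HasFDerivAt (fderiv ℝ u) A p :=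
    ((hcd.fderiv_right (m := 1) (by norm_num)).differentiableAt (by norm_num)).hasFDerivAt
  have hsym : ∀ v w, A v w = A w v := fun v w =>
    (hcd.isSymmSndFDerivAt (by simp)) v w
  set x := fderiv ℝ u p E0 with hx
  set y := fderiv ℝ u p E1 with hy
  set W := Real.sqrt (1 + x ^ 2 + y ^ 2) with hW
  have hpos : 0 < 1 + x ^ 2 + y ^ 2 := by positivity
  have hWpos : 0 < W := Real.sqrt_pos.2 hpos
  have key : ∀ c d : ℝ, s * ((-(c * A E0 E1 + d * A E1 E1) * c + (c * A E0 E0 + d * A E0 E1) * d) / W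
      - (-y * c + x * d) * (x * (c * A E0 E0 + d * A E0 E1) + y * (c * A E0 E1 + d * A E1 E1)) / W ^ 3)
      + 2 * ε * (c ^ 2 + d ^ 2) ≤ 0 := by
    intro c d
    set e : Pt := c • E0 + d • E1 with he
    have hline : ∀ t : ℝ, HasDerivAt (fun t : ℝ => p + t • e) e t := by
      intro t
      simpa using ((hasDerivAt_id t).smul_const e).const_add p
    have hcl : ContinuousAt (fun t : ℝ => p + t • e) 0 := (hline 0).continuousAt
    have hin : ∀ᶠ t in 𝓝 (0:ℝ), p + t • e ∈ Ω :=
      hcl.eventually (by simpa using hΩ.mem_nhds hp)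
    have he0 : e 0 = c := by simp [he, hE0, hE1]
    have he1 : e 1 = d := by simp [he, hE0, hE1]
    let X : ℝ → ℝ := fun t => fderiv ℝ u (p + t • e) E0
    let Y : ℝ → ℝ := fun t => fderiv ℝ u (p + t • e) E1
    have hXY : ∀ v, HasDerivAt (fun t : ℝ => fderiv ℝ u (p + t • e) v) (A e v) 0 := by
      intro v
      have h1 : HasDerivAt (fun t : ℝ => fderiv ℝ u (p + t • e)) (A e) 0 := by
        have : HasFDerivAt (fderiv ℝ u) A (p + (0:ℝ) • e) := by simpa using hAd
        exact this.comp_hasDerivAt (0:ℝ) (hline 0)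
      simpa using h1.clm_apply (hasDerivAt_const (0:ℝ) v)
    have hX : HasDerivAt X (c * A E0 E0 + d * A E0 E1) 0 := by
      have := hXY E0
      simp only [he, map_add, map_smul, add_apply,
        smul_apply, smul_eq_mul, hsym E1 E0] at this
      exact this
    have hY : HasDerivAt Y (c * A E0 E1 + d * A E1 E1) 0 := by
      have := hXY E1
      simp only [he, map_add, map_smul, add_apply,
        smul_apply, smul_eq_mul] at this
      exact this
    have hX0 : X 0 = x := by simp [X, hx]
    have hY0 : Y 0 = y := by simp [Y, hy]
    set φ : ℝ → ℝ := fun t => s * ψ (p + t • e) + ε * ‖p + t • e‖ ^ 2 with hφ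
    set φ' : ℝ → ℝ := fun t => s * ((-Y t * c + X t * d) / Real.sqrt (1 + X t ^ 2 + Y t ^ 2))
      + ε * (2 * inner ℝ (p + t • e) e) with hφ'
    have hlm : IsLocalMax φ 0 := by
      have hm : IsLocalMax (fun q => s * ψ q + ε * ‖q‖ ^ 2) (p + (0:ℝ) • e) := by simpa using hmax
      exact hm.comp_continuous (g := fun t : ℝ => p + t • e) hcl
    have h1 : ∀ᶠ t in 𝓝 (0:ℝ), HasDerivAt φ (φ' t) t := by
      filter_upwards [hin] with t ht
      obtain ⟨hd, hg⟩ := hgrad _ ht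
      have a1 : HasDerivAt (fun t : ℝ => ψ (p + t • e)) (fderiv ℝ ψ (p + t • e) e) t :=
        hd.hasFDerivAt.comp_hasDerivAt t (hline t)
      have a2 : fderiv ℝ ψ (p + t • e) e = (-Y t * c + X t * d) / Real.sqrt (1 + X t ^ 2 + Y t ^ 2) := by
        rw [he, map_add, map_smul, map_smul, hE0, hE1, ← grad_coord, ← grad_coord, hg, conjField, Wu_eq]
        simp only [grad_coord, vec2, ← hE0, ← hE1, ← he, X, Y]
        simp
        ring
      have a3 := (hline t).norm_sq
      rw [a2] at a1
      exact (a1.const_mul s).add (a3.const_mul ε)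
    have hS : HasDerivAt (fun t => Real.sqrt (1 + X t ^ 2 + Y t ^ 2))
        ((x * (c * A E0 E0 + d * A E0 E1) + y * (c * A E0 E1 + d * A E1 E1)) / W) 0 := by
      have hsq : HasDerivAt (fun t => 1 + X t ^ 2 + Y t ^ 2)
          (2 * (x * (c * A E0 E0 + d * A E0 E1) + y * (c * A E0 E1 + d * A E1 E1))) 0 := by
        refine (((hX.pow 2).const_add 1).add (hY.pow 2)).congr_deriv ?_
        rw [hX0, hY0]
        push_cast
        ring
      refine (hsq.sqrt (by rw [hX0, hY0]; exact hpos.ne')).congr_deriv ?_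
      rw [hX0, hY0, ← hW]
      field_simp
    have hN : HasDerivAt (fun t => -Y t * c + X t * d)
        (-(c * A E0 E1 + d * A E1 E1) * c + (c * A E0 E0 + d * A E0 E1) * d) 0 :=
      (hY.neg.mul_const c).add (hX.mul_const d)
    have hI : HasDerivAt (fun t : ℝ => (inner ℝ (p + t • e) e : ℝ)) (c ^ 2 + d ^ 2) 0 := by
      have := (hline 0).inner ℝ (hasDerivAt_const (0:ℝ) e)
      refine this.congr_deriv ?_
      rw [real_inner_self_eq_norm_sq, EuclideanSpace.real_norm_sq_eq, Fin.sum_univ_two, he0, he1]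
      simp
    have h2 := ((hN.div hS (by rw [hX0, hY0]; exact hWpos.ne')).const_mul s).add
      ((hI.const_mul 2).const_mul ε)
    have h3 := local_max_second h1 h2 hlm
    simp only [hX0, hY0, ← hW] at h3
    refine le_of_eq_of_le ?_ h3
    field_simp
  have k1 := key 1 0
  have k2 := key 0 1
  have k3 := key (-y) x
  have hW2 : W ^ 2 = 1 + x ^ 2 + y ^ 2 := Real.sq_sqrt hpos.le
  generalize A E0 E0 = a at *
  generalize A E0 E1 = b at *
  generalize A E1 E1 = c at *
  have hsum := add_nonpos (add_nonpos k1 k2) k3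
  have hid : ∀ N M : ℝ, N / W - M / W ^ 3 = (N * (1 + x ^ 2 + y ^ 2) - M) / W ^ 3 := by
    intro N M
    rw [← hW2]
    field_simp
  simp only [hid] at hsum
  have : 2 * ε * (2 + x ^ 2 + y ^ 2) ≤ 0 := by
    refine le_of_eq_of_le ?_ hsum
    ring
  have : 0 < 2 * ε * (2 + x ^ 2 + y ^ 2) := by positivity
  linarith

lemma weak_max (Ω : Set Pt) (hΩ : IsOpen Ω) (hbd : Bornology.IsBounded Ω)
    (u ψ : Pt → ℝ) (hu : ContDiffOn ℝ 2 u Ω) (hcont : ContinuousOn ψ (closure Ω))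
    (hgrad : ∀ p ∈ Ω, DifferentiableAt ℝ ψ p ∧ gradient ψ p = conjField u p)
    (s M : ℝ) (hM : ∀ x ∈ frontier Ω, s * ψ x ≤ M) (p : Pt) (hp : p ∈ Ω) : s * ψ p ≤ M := by
  have hK : IsCompact (closure Ω) := hbd.isCompact_closure
  obtain ⟨R, hR⟩ := hK.isBounded.exists_norm_le
  have main : ∀ ε : ℝ, 0 < ε → s * ψ p ≤ M + ε * R ^ 2 := by
    intro ε hε
    obtain ⟨q, hq, hqm⟩ := hK.exists_isMaxOn ⟨p, subset_closure hp⟩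
      (f := fun q => s * ψ q + ε * ‖q‖ ^ 2) (by fun_prop)
    have hqΩ : q ∉ Ω := fun h => no_interior_max Ω hΩ u ψ hu hgrad s ε hε q h
      (hqm.isLocalMax (mem_of_superset (hΩ.mem_nhds h) subset_closure))
    have hqf : q ∈ frontier Ω := by rw [hΩ.frontier_eq]; exact ⟨hq, hqΩ⟩
    have h1 := hqm (subset_closure hp)
    simp only [mem_ofPred_eq] at h1
    have h2 := hM q hqf
    have h3 : ‖q‖ ^ 2 ≤ R ^ 2 := pow_le_pow_left₀ (norm_nonneg _) (hR q hq) 2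
    have h4 : ε * ‖q‖ ^ 2 ≤ ε * R ^ 2 := by gcongr
    have h5 : 0 ≤ ε * ‖p‖ ^ 2 := by positivity
    linarith
  refine le_of_forall_pos_le_add fun δ hδ => ?_
  have h := main (δ / (R ^ 2 + 1)) (by positivity)
  have : δ / (R ^ 2 + 1) * R ^ 2 ≤ δ := by
    rw [div_mul_eq_mul_div, div_le_iff₀ (by positivity)]
    nlinarith
  linarith

/-- Maximum principle for the conjugate function: on a bounded domain, the continuous
extension `ψ̄` of a conjugate function of a minimal graph attains values between the
infimum and the supremum of its boundary values; in particular `0 ≤ ψ̄ ≤ 1` on `Ω` as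
soon as `0 ≤ ψ̄ ≤ 1` on `∂Ω`. -/
theorem conjugate_maximum_principle
    (Ω : Set Pt) (hΩ : IsOpen Ω) (hbd : Bornology.IsBounded Ω)
    (u ψb : Pt → ℝ) (hu : MinimalGraph Ω u)
    (hcont : ContinuousOn ψb (closure Ω))
    (hgrad : ∀ p ∈ Ω, DifferentiableAt ℝ ψb p ∧ gradient ψb p = conjField u p) :
    (∀ p ∈ Ω, sInf (ψb '' frontier Ω) ≤ ψb p ∧ ψb p ≤ sSup (ψb '' frontier Ω)) ∧
    ((∀ x ∈ frontier Ω, ψb x ∈ Icc (0:ℝ) 1) → ∀ p ∈ Ω, ψb p ∈ Icc (0:ℝ) 1) := by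
  have hcd := hu.2.1
  have hcf : IsCompact (ψb '' frontier Ω) :=
    (hbd.isCompact_closure.of_isClosed_subset isClosed_frontier frontier_subset_closure).image_of_continuousOn
      (hcont.mono frontier_subset_closure)
  have up : ∀ M, (∀ x ∈ frontier Ω, ψb x ≤ M) → ∀ p ∈ Ω, ψb p ≤ M := by
    intro M hM p hp
    have := weak_max Ω hΩ hbd u ψb hcd hcont hgrad 1 M (by simpa using hM) p hp
    simpa using this
  have lo : ∀ m, (∀ x ∈ frontier Ω, m ≤ ψb x) → ∀ p ∈ Ω, m ≤ ψb p := by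
    intro m hm p hp
    have := weak_max Ω hΩ hbd u ψb hcd hcont hgrad (-1) (-m) (by simpa using hm) p hp
    simpa using this
  refine ⟨fun p hp => ⟨lo _ (fun x hx => csInf_le hcf.bddBelow (mem_image_of_mem _ hx)) p hp,
    up _ (fun x hx => le_csSup hcf.bddAbove (mem_image_of_mem _ hx)) p hp⟩, fun h p hp =>
    ⟨lo _ (fun x hx => (h x hx).1) p hp, up _ (fun x hx => (h x hx).2) p hp⟩⟩
end
end
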